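/- arXiv:2410.08825 — 12 statements merged into one kernel-verified Lean document; each statement's English description precedes it below -/
import Mathlib

section
/- Let α and β be real numbers with 1/2 ≤ α ≤ 1, α/2 ≤ β ≤ α², and (α,β) ≠ (1,1). Then every GCB(α,β)-tree with N ≥ 1 nodes has height h ≤ −2·log_β(N+1) (where log_β denotes the logarithm in base β, which is negative since β < 1). -/
/-- Binary trees: `leaf` is the empty tree, `node l r` is a node with subtrees `l` and `r`. -/
inductive BTree : Type
  | leaf : BTree
  | node : BTree → BTree → BTree

namespace BTree

/-- The weight of a binary tree: its number of empty subtrees. -/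
def weight : BTree → ℕ
  | .leaf => 1
  | .node l r => weight l + weight r

/-- The number of nodes of a binary tree. -/
def numNodes : BTree → ℕ
  | .leaf => 0
  | .node l r => numNodes l + numNodes r + 1

/-- The (real-valued) weights of the two child subtrees of a tree; each child subtree of
an empty tree is given weight `1/2`. -/
noncomputable def childWeights : BTree → List ℝ
  | .leaf => [1/2, 1/2]
  | .node l r => [(weight l : ℝ), (weight r : ℝ)]

/-- `IsGCB α β T` : every node `n` of `T` satisfies `|c| ≤ α * |n|` for each of its two child
subtrees `c` and `|g| ≤ β * |n|` for each of its four grandchild subtrees `g`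
(child subtrees of an empty child having weight `1/2`). -/
def IsGCB (α β : ℝ) : BTree → Prop
  | .leaf => True
  | .node l r =>
      (∀ c ∈ childWeights (.node l r), c ≤ α * weight (.node l r)) ∧
      (∀ g ∈ childWeights l ++ childWeights r, g ≤ β * weight (.node l r)) ∧
      IsGCB α β l ∧ IsGCB α β r

/-- Number of levels of a binary tree (empty tree has 0 levels). -/
def levels : BTree → ℕ
  | .leaf => 0
  | .node l r => max (levels l) (levels r) + 1

/-- Height of a binary tree: the maximum depth of a node (root at depth 0).
For a nonempty tree this is `levels - 1`. -/
def height (t : BTree) : ℕ := levels t - 1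

/-- External path length: the sum over all empty subtrees of their depths. -/
def epl : BTree → ℕ
  | .leaf => 0
  | .node l r => epl l + epl r + weight l + weight r

/-- Internal path length: the sum over all nodes of their depths. -/
def ipl : BTree → ℕ
  | .leaf => 0
  | .node l r => ipl l + ipl r + numNodes l + numNodes r

/-- The sum of the weights of all nodes of a binary tree. -/
def weightSum : BTree → ℕ
  | .leaf => 0
  | .node l r => weight (.node l r) + weightSum l + weightSum r

end BTree

/-- Shannon's binary entropy, in base 2. -/
noncomputable def H2 (x : ℝ) : ℝ := -x * Real.logb 2 x - (1 - x) * Real.logb 2 (1 - x)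

namespace BTree

theorem weight_eq_numNodes_add_one (t : BTree) : t.weight = t.numNodes + 1 := by
  induction t with
  | leaf => rfl
  | node l r ihl ihr => simp only [weight, numNodes]; omega

theorem levels_pos_of_numNodes_pos {t : BTree} (h : 1 ≤ t.numNodes) : 1 ≤ t.levels := by
  cases t with
  | leaf => simp [numNodes] at h
  | node l r => simp [levels]

theorem two_le_weight_of_levels_pos {t : BTree} (h : 1 ≤ t.levels) : 2 ≤ t.weight := by
  cases t with
  | leaf => simp [levels] at h
  | node l r =>
    have hl := weight_eq_numNodes_add_one l
    have hr := weight_eq_numNodes_add_one r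
    simp only [weight]
    omega

/-- A tree with `n + 1` levels has a child subtree with `n` levels. -/
theorem IsGCB.exists_child {α β : ℝ} {t : BTree} (ht : IsGCB α β t) {n : ℕ}
    (hn : t.levels = n + 1) :
    ∃ c : BTree, IsGCB α β c ∧ c.levels = n ∧ (c.weight : ℝ) ≤ α * t.weight ∧
      ∀ g ∈ c.childWeights, g ≤ β * t.weight := by
  cases t with
  | leaf => simp [levels] at hn
  | node l r =>
    obtain ⟨hc, hg, hl, hr⟩ := ht
    simp only [levels, Nat.add_right_cancel_iff] at hn
    rcases le_total l.levels r.levels with h | h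
    · exact ⟨r, hr, by rw [← hn, max_eq_right h], hc _ (by simp [childWeights]),
        fun g hgr => hg g (List.mem_append_right _ hgr)⟩
    · exact ⟨l, hl, by rw [← hn, max_eq_left h], hc _ (by simp [childWeights]),
        fun g hgl => hg g (List.mem_append_left _ hgl)⟩

/-- A tree with `n + 2` levels has a grandchild subtree with `n` levels. -/
theorem IsGCB.exists_grandchild {α β : ℝ} {t : BTree} (ht : IsGCB α β t) {n : ℕ}
    (hn : t.levels = n + 2) :
    ∃ g : BTree, IsGCB α β g ∧ g.levels = n ∧ (g.weight : ℝ) ≤ β * t.weight := by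
  obtain ⟨c, hc, hcn, -, hg⟩ := ht.exists_child hn
  cases c with
  | leaf => simp [levels] at hcn
  | node l r =>
    obtain ⟨-, -, hl, hr⟩ := hc
    simp only [levels, Nat.add_right_cancel_iff] at hcn
    rcases le_total l.levels r.levels with h | h
    · exact ⟨r, hr, by rw [← hcn, max_eq_right h], hg _ (by simp [childWeights])⟩
    · exact ⟨l, hl, by rw [← hcn, max_eq_left h], hg _ (by simp [childWeights])⟩

/-- A tree with `n + 2 * k` levels has a subtree with `n` levels at depth `2 * k`. -/
theorem IsGCB.exists_descendant {α β : ℝ} (hβ : 0 ≤ β) {n : ℕ} (k : ℕ) {t : BTree}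
    (ht : IsGCB α β t) (hn : t.levels = n + 2 * k) :
    ∃ d : BTree, IsGCB α β d ∧ d.levels = n ∧ (d.weight : ℝ) ≤ β ^ k * t.weight := by
  induction k generalizing t with
  | zero => exact ⟨t, ht, hn, by simp⟩
  | succ k ih =>
    obtain ⟨g, hg, hgn, hgw⟩ := ht.exists_grandchild (n := n + 2 * k) (by omega)
    obtain ⟨d, hd, hdn, hdw⟩ := ih hg hgn
    refine ⟨d, hd, hdn, hdw.trans ?_⟩
    calc β ^ k * g.weight ≤ β ^ k * (β * t.weight) := by gcongr
      _ = β ^ (k + 1) * t.weight := by ring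

theorem IsGCB.one_le_pow_height_mul_sq_weight {α β : ℝ} (hα₁ : 1/2 ≤ α) (hα₂ : α ≤ 1)
    (hβ : α/2 ≤ β) {t : BTree} (ht : IsGCB α β t) (hn : 1 ≤ t.numNodes) :
    1 ≤ β ^ t.height * (t.weight : ℝ) ^ 2 := by
  have hβ0 : 0 ≤ β := by linarith
  have hlev := levels_pos_of_numNodes_pos hn
  obtain ⟨k, hk | hk⟩ : ∃ k, t.levels = 1 + 2 * k ∨ t.levels = 2 + 2 * k :=
    ⟨(t.levels - 1) / 2, by omega⟩
  · obtain ⟨d, -, hdn, hdw⟩ := ht.exists_descendant hβ0 k hk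
    have hd : (2 : ℝ) ≤ d.weight := by exact_mod_cast two_le_weight_of_levels_pos hdn.ge
    have hh : t.height = 2 * k := by unfold height; omega
    calc (1 : ℝ) ≤ (β ^ k * t.weight) ^ 2 := one_le_pow₀ (by linarith)
      _ = β ^ t.height * (t.weight : ℝ) ^ 2 := by rw [hh]; ring
  · obtain ⟨d, hd, hdn, hdw⟩ := ht.exists_descendant hβ0 k hk
    obtain ⟨c, -, hcn, hcw, -⟩ := hd.exists_child (n := 1) hdn
    have hc : (2 : ℝ) ≤ c.weight := by exact_mod_cast two_le_weight_of_levels_pos hcn.ge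
    have hh : t.height = 2 * k + 1 := by unfold height; omega
    have hx0 : (0 : ℝ) ≤ β ^ k * t.weight := by positivity
    have hx : 2 ≤ α * (β ^ k * t.weight) :=
      (hc.trans hcw).trans (mul_le_mul_of_nonneg_left hdw (by linarith))
    have hsq : β ^ t.height * (t.weight : ℝ) ^ 2 = β * (β ^ k * t.weight) ^ 2 := by
      rw [hh]; ring
    rw [hsq]
    generalize β ^ k * (t.weight : ℝ) = x at hx0 hx
    have hx2 : 2 ≤ x := hx.trans (mul_le_of_le_one_left hx0 hα₂)
    calc (1 : ℝ) ≤ 2 / 2 * x := by linarith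
      _ ≤ α * x / 2 * x := by gcongr
      _ = α / 2 * x ^ 2 := by ring
      _ ≤ β * x ^ 2 := by gcongr

end BTree

theorem gcb_height_upper_bound (α β : ℝ)
    (hα₁ : 1/2 ≤ α) (hα₂ : α ≤ 1) (hβ₁ : α/2 ≤ β) (hβ₂ : β ≤ α^2)
    (hne : (α, β) ≠ (1, 1))
    (T : BTree) (hT : BTree.IsGCB α β T) (hN : 1 ≤ T.numNodes) :
    (T.height : ℝ) ≤ -2 * Real.logb β ((T.numNodes : ℝ) + 1) := by
  have hβ0 : 0 < β := by linarith
  have hβ1 : β < 1 := by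
    rcases hα₂.lt_or_eq with h | rfl
    · nlinarith
    · exact lt_of_le_of_ne (by linarith) fun h => hne (by rw [h])
  have key := hT.one_le_pow_height_mul_sq_weight hα₁ hα₂ hβ₁ hN
  rw [T.weight_eq_numNodes_add_one] at key
  push_cast at key
  have hlog := Real.log_nonneg key
  rw [Real.log_mul (by positivity) (by positivity), Real.log_pow, Real.log_pow] at hlog
  rw [Real.logb, mul_div_assoc', le_div_iff_of_neg (Real.log_neg hβ0 hβ1)]
  push_cast at hlog
  linarith
end

section
/- Let α and β be real numbers with 1/2 ≤ α ≤ 1, α/2 ≤ β ≤ α², and (α,β) ≠ (1,1). In a GCB(α,β)-tree, if m is a node lying at distance k below a node n (so n is the k-th ancestor of m), then |m| ≤ β^{k/2}·|n| when k is even, and |m| ≤ α·β^{(k−1)/2}·|n| when k is odd. -/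
/-- `SubtreeAt k n m` : the tree `m` occurs as a subtree of `n` at depth `k`,
i.e. `n` is the `k`-th ancestor of `m`. -/
inductive SubtreeAt : ℕ → BTree → BTree → Prop
  | refl (t : BTree) : SubtreeAt 0 t t
  | left {k : ℕ} {l r t : BTree} : SubtreeAt k l t → SubtreeAt (k + 1) (BTree.node l r) t
  | right {k : ℕ} {l r t : BTree} : SubtreeAt k r t → SubtreeAt (k + 1) (BTree.node l r) t

/-- In a GCB tree, each subtree at depth at least two lies below a grandchild of the root, which
is again a GCB tree and has at most `β` times the weight of the root. -/
theorem BTree.IsGCB.exists_grandchild_s1 {α β : ℝ} {n m : BTree} {k : ℕ}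
    (hn : BTree.IsGCB α β n) (h : SubtreeAt (k + 2) n m) :
    ∃ g, BTree.IsGCB α β g ∧ (g.weight : ℝ) ≤ β * n.weight ∧ SubtreeAt k g m := by
  cases h with
  | left h | right h =>
    obtain ⟨-, hg, hl, hr⟩ := hn
    cases h with
    | left h | right h =>
      refine ⟨_, ?_, hg _ ?_, h⟩
      · first
          | exact hl.2.2.1
          | exact hl.2.2.2
          | exact hr.2.2.1
          | exact hr.2.2.2
      · simp [BTree.childWeights]

/-- In a GCB tree, each child of the root has at most `α` times the weight of the root. -/
theorem BTree.IsGCB.weight_child_le {α β : ℝ} {n m : BTree}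
    (hn : BTree.IsGCB α β n) (h : SubtreeAt 1 n m) :
    (m.weight : ℝ) ≤ α * n.weight := by
  cases h with
  | left h | right h =>
    cases h
    exact hn.1 _ (by simp [BTree.childWeights])

/-- A weight bound at depth `k` extends to depth `2 * j + k` with an extra factor `β ^ j`. -/
theorem BTree.IsGCB.weight_le_of_weight_le {α β γ : ℝ} (hβ : 0 ≤ β) (hγ : 0 ≤ γ) {m : BTree}
    {k : ℕ} (hk : ∀ n, BTree.IsGCB α β n → SubtreeAt k n m → (m.weight : ℝ) ≤ γ * n.weight)
    (j : ℕ) {n : BTree} (hn : BTree.IsGCB α β n) (h : SubtreeAt (2 * j + k) n m) :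
    (m.weight : ℝ) ≤ γ * β ^ j * n.weight := by
  induction j generalizing n with
  | zero => simpa using hk n hn (by simpa using h)
  | succ j ih =>
    obtain ⟨g, hg, hw, hs⟩ :=
      hn.exists_grandchild_s1 (k := 2 * j + k) (by convert h using 1; ring)
    calc (m.weight : ℝ) ≤ γ * β ^ j * g.weight := ih hg hs
      _ ≤ γ * β ^ j * (β * n.weight) := by gcongr
      _ = γ * β ^ (j + 1) * n.weight := by ring

theorem gcb_descendant_weight_bound (α β : ℝ)
    (hα₁ : 1/2 ≤ α) (hα₂ : α ≤ 1) (hβ₁ : α/2 ≤ β) (hβ₂ : β ≤ α^2)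
    (hne : (α, β) ≠ (1, 1))
    (n m : BTree) (k : ℕ) (hn : BTree.IsGCB α β n)
    (hsub : SubtreeAt k n m) (hm : m ≠ BTree.leaf) :
    if k % 2 = 0 then (m.weight : ℝ) ≤ β ^ (k / 2) * n.weight
    else (m.weight : ℝ) ≤ α * β ^ ((k - 1) / 2) * n.weight := by
  have hα : 0 ≤ α := by linarith
  have hβ : 0 ≤ β := by linarith
  split_ifs with hk
  · have := BTree.IsGCB.weight_le_of_weight_le (k := 0) hβ zero_le_one
      (fun n _ h => by cases h; simp) (k / 2) hn (m := m) (by convert hsub using 1; omega)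
    simpa using this
  · exact BTree.IsGCB.weight_le_of_weight_le hβ hα (fun n hn h => hn.weight_child_le h)
      ((k - 1) / 2) hn (by convert hsub using 1; omega)
end

section
/- Let α and β be real numbers with 1/2 ≤ α ≤ 1, α/2 ≤ β ≤ α², and (α,β) ≠ (1,1), and let Δ = (H₂(α) + α·H₂(β/α))/(1+α). Then every GCB(α,β)-tree with N nodes has external path length λ ≤ (N+1)·log₂(N+1)/Δ. -/
namespace Real

theorem binEntropy_le_of_le_of_one_sub_le {x u : ℝ} (hx : x ≤ u) (hx' : 1 - x ≤ u) (hu : u ≤ 1) :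
    binEntropy u ≤ binEntropy x := by
  have key : ∀ y : ℝ, 2⁻¹ ≤ y → y ≤ u → binEntropy u ≤ binEntropy y := fun y h1 h2 =>
    binEntropy_strictAntiOn.antitoneOn ⟨h1, h2.trans hu⟩ ⟨h1.trans h2, hu⟩ h2
  rcases le_total (2⁻¹ : ℝ) x with h | h
  · exact key x h hx
  · rw [← binEntropy_one_sub x]
    exact key (1 - x) (by norm_num at h ⊢; linarith) hx'

theorem negMulLog_le_tangent {x y : ℝ} (hx : 0 < x) (hy : 0 ≤ y) :
    negMulLog y ≤ negMulLog x + (y - x) * (-log x - 1) := by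
  rcases hy.eq_or_lt with rfl | hy
  · simp only [negMulLog]
    nlinarith
  · have h := mul_le_mul_of_nonneg_left (log_le_sub_one_of_pos (div_pos hx hy)) hy.le
    rw [log_div hx.ne' hy.ne', mul_sub, mul_sub, mul_div_cancel₀ _ hy.ne'] at h
    simp only [negMulLog]
    linarith

/-- Chain rule for the entropy of the distribution `(b, p - b, 1 - p)`. -/
theorem binEntropy_add_mul_binEntropy_div {b p : ℝ} (hb : 0 < b) (hbp : b ≤ p) :
    binEntropy p + p * binEntropy (b / p) = negMulLog (1 - p) + negMulLog (p - b) + negMulLog b := by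
  have hp : 0 < p := hb.trans_le hbp
  have h1 : 1 - b / p = (p - b) / p := by field_simp
  rcases hbp.eq_or_lt with rfl | hlt
  · simp only [binEntropy_eq_negMulLog_add_negMulLog_one_sub, div_self hp.ne']
    simp
    ring
  · simp only [binEntropy_eq_negMulLog_add_negMulLog_one_sub, h1, negMulLog,
      log_div hb.ne' hp.ne', log_div (sub_pos.2 hlt).ne' hp.ne']
    field_simp
    ring

/-- Splitting off `s` twice from the unit mass loses no entropy per expected step, compared to
splitting off `a` first and then `s ^ 2 / a`. -/
theorem binEntropy_add_mul_binEntropy_sq_div_le {s a : ℝ} (hs : 1 / 2 ≤ s) (hs1 : s < 1)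
    (hsa : s ≤ a) (ha : a ≤ 1) :
    binEntropy a + a * binEntropy (s ^ 2 / a) ≤ (1 + a) * binEntropy s := by
  have hs0 : 0 < s := by linarith
  have hss : s ^ 2 < s := by nlinarith
  have hE := binEntropy_add_mul_binEntropy_div (b := s ^ 2) (p := s) (by positivity) hss.le
  have h1 := negMulLog_le_tangent (x := 1 - s) (y := 1 - a) (by linarith) (by linarith)
  have h2 := negMulLog_le_tangent (x := s - s ^ 2) (y := a - s ^ 2) (by linarith) (by linarith)
  have hdiv : s ^ 2 / s = s := by field_simp
  rw [hdiv] at hE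
  rw [binEntropy_add_mul_binEntropy_div (by positivity) (hss.le.trans hsa)]
  have hlog : log (s - s ^ 2) = log s + log (1 - s) := by
    rw [← log_mul hs0.ne' (by linarith)]
    ring_nf
  rw [hlog] at h2
  have hmono : log (1 - s) ≤ log s := log_le_log (by linarith) (by linarith)
  have hslope : -log s ≤ binEntropy s := by
    rw [binEntropy_eq_negMulLog_add_negMulLog_one_sub]
    simp only [negMulLog]
    nlinarith
  nlinarith [mul_le_mul_of_nonneg_left hslope (sub_nonneg.2 hsa)]

theorem concaveOn_negMulLog_split (b D : ℝ) :
    ConcaveOn ℝ (Set.Icc b 1) fun x =>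
      negMulLog (1 - x) + negMulLog (x - b) + negMulLog b - (1 + x) * D := by
  refine ⟨convex_Icc _ _, fun x hx y hy u v hu hv huv => ?_⟩
  have h1 := concaveOn_negMulLog.2 (x := 1 - x) (y := 1 - y) (by simpa using hx.2)
    (by simpa using hy.2) hu hv huv
  have h2 := concaveOn_negMulLog.2 (x := x - b) (y := y - b) (by simpa using hx.1)
    (by simpa using hy.1) hu hv huv
  obtain rfl : v = 1 - u := by linarith
  simp only [smul_eq_mul] at h1 h2 ⊢
  rw [show u * (1 - x) + (1 - u) * (1 - y) = 1 - (u * x + (1 - u) * y) by ring] at h1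
  rw [show u * (x - b) + (1 - u) * (y - b) = u * x + (1 - u) * y - b by ring] at h2
  linarith

theorem mul_log_add {a b : ℝ} (ha : 0 < a) (hb : 0 < b) :
    (a + b) * log (a + b) = a * log a + b * log b + (a + b) * binEntropy (a / (a + b)) := by
  have hab : 0 < a + b := add_pos ha hb
  have h1 : 1 - a / (a + b) = b / (a + b) := by field_simp; ring
  rw [binEntropy_eq_negMulLog_add_negMulLog_one_sub, h1]
  simp only [negMulLog, log_div ha.ne' hab.ne', log_div hb.ne' hab.ne']
  field_simp
  ring

end Real

theorem H2_eq_binEntropy_div (x : ℝ) : H2 x = Real.binEntropy x / Real.log 2 := by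
  rw [H2, Real.binEntropy_eq_negMulLog_add_negMulLog_one_sub]
  simp only [Real.negMulLog, Real.logb]
  ring

namespace BTree

theorem weight_pos (t : BTree) : 0 < t.weight := by
  rw [weight_eq_numNodes_add_one]
  exact Nat.succ_pos _

/-- The amount by which `|T| log |T|` exceeds `D` times the external path length of `T`. -/
noncomputable def entropySurplus (D : ℝ) (t : BTree) : ℝ :=
  t.weight * Real.log t.weight - D * t.epl

theorem entropySurplus_node (D : ℝ) (l r : BTree) :
    entropySurplus D (node l r) = entropySurplus D l + entropySurplus D r +
      (l.weight + r.weight) *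
        (Real.binEntropy (l.weight / (l.weight + r.weight)) - D) := by
  have h := Real.mul_log_add (a := l.weight) (b := r.weight)
    (by exact_mod_cast l.weight_pos) (by exact_mod_cast r.weight_pos)
  simp only [entropySurplus, weight, epl]
  push_cast
  linarith

/-- A heavy child `l` whose own children are bounded makes up for an unbalanced split. -/
theorem balance_nonneg_of_heavy_child {a b s D : ℝ} (hs : 1 / 2 ≤ s) (hs1 : s ≤ 1)
    (hsb : s ^ 2 = b) (hD : D ≤ Real.binEntropy s)
    (hchain : ∀ p, s ≤ p → p ≤ a →
      (1 + p) * D ≤ Real.binEntropy p + p * Real.binEntropy (b / p))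
    {l r : BTree} (hlr : r.weight ≤ l.weight)
    (hl : (l.weight : ℝ) ≤ a * (l.weight + r.weight))
    (hg : ∀ g ∈ childWeights l, g ≤ b * (l.weight + r.weight))
    (hl0 : 0 ≤ entropySurplus D l) (hr0 : 0 ≤ entropySurplus D r)
    (hsplit : ∀ x y, l = node x y → ((x.weight : ℝ) + y.weight) *
      (Real.binEntropy (x.weight / (x.weight + y.weight)) - D) ≤ entropySurplus D l) :
    0 ≤ entropySurplus D l + entropySurplus D r +
      (l.weight + r.weight) *
        (Real.binEntropy (l.weight / (l.weight + r.weight)) - D) := by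
  have hlp : (0 : ℝ) < l.weight := by exact_mod_cast l.weight_pos
  have hrp : (0 : ℝ) < r.weight := by exact_mod_cast r.weight_pos
  have hlr' : (r.weight : ℝ) ≤ l.weight := by exact_mod_cast hlr
  have hw : (0 : ℝ) < l.weight + r.weight := add_pos hlp hrp
  set w : ℝ := l.weight + r.weight with hw_def
  set p : ℝ := l.weight / w with hp_def
  have hpw : (l.weight : ℝ) = p * w := by rw [hp_def]; field_simp
  have hp_half : 1 / 2 ≤ p := by rw [hp_def, le_div_iff₀ hw]; linarith
  have hp0 : 0 < p := by linarith
  have hpa : p ≤ a := by rw [hp_def, div_le_iff₀ hw]; exact hl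
  rcases le_total p s with hps | hsp
  · have := Real.binEntropy_le_of_le_of_one_sub_le hps (by linarith) hs1
    have := mul_nonneg hw.le (by linarith : 0 ≤ Real.binEntropy p - D)
    linarith
  · cases l with
    | leaf =>
      have hr1 : (r.weight : ℝ) = 1 := by
        have : r.weight = 1 := le_antisymm hlr r.weight_pos
        exact_mod_cast this
      have hp_eq : p = 1 / 2 := by
        rw [hp_def, hw_def, hr1]; norm_num [weight]
      have hs_eq : s = p := by linarith
      have := mul_nonneg hw.le (by rw [← hs_eq]; linarith : 0 ≤ Real.binEntropy p - D)
      linarith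
    | node x y =>
      have hx : (x.weight : ℝ) ≤ b * w := hg _ (by simp [childWeights])
      have hy : (y.weight : ℝ) ≤ b * w := hg _ (by simp [childWeights])
      have hxy : ((node x y).weight : ℝ) = x.weight + y.weight := by simp [weight]
      have hxy0 : (0 : ℝ) < x.weight + y.weight := hxy ▸ hlp
      have hbp : b / p = b * w / (x.weight + y.weight) := by
        rw [← hxy, hpw]; field_simp
      have hbp1 : b / p ≤ 1 := by
        rw [div_le_one hp0, ← hsb]; nlinarith
      have hq := Real.binEntropy_le_of_le_of_one_sub_le
        (x := x.weight / ((x.weight : ℝ) + y.weight)) (u := b / p)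
        (by rw [hbp]; gcongr)
        (by
          rw [hbp, one_sub_div hxy0.ne', add_sub_cancel_left]
          gcongr) hbp1
      have h1 := hsplit x y rfl
      rw [← hxy, hpw] at h1
      rw [← hxy] at hq
      have h2 := hchain p hsp hpa
      have h3 := mul_le_mul_of_nonneg_left hq (mul_pos hp0 hw).le
      have h4 := mul_le_mul_of_nonneg_left h2 hw.le
      rw [hpw] at h3
      linarith

theorem entropySurplus_nonneg {a b s D : ℝ} (hs : 1 / 2 ≤ s) (hs1 : s ≤ 1)
    (hsb : s ^ 2 = b) (hD : D ≤ Real.binEntropy s)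
    (hchain : ∀ p, s ≤ p → p ≤ a →
      (1 + p) * D ≤ Real.binEntropy p + p * Real.binEntropy (b / p))
    (t : BTree) (ht : IsGCB a b t) : 0 ≤ entropySurplus D t := by
  suffices 0 ≤ entropySurplus D t ∧ ∀ x y, t = node x y → ((x.weight : ℝ) + y.weight) *
      (Real.binEntropy (x.weight / (x.weight + y.weight)) - D) ≤ entropySurplus D t from this.1
  induction t with
  | leaf => exact ⟨by simp [entropySurplus, weight, epl], by simp⟩
  | node l r ihl ihr =>
    obtain ⟨hc, hg, hl, hr⟩ := ht
    obtain ⟨hl0, hl1⟩ := ihl hl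
    obtain ⟨hr0, hr1⟩ := ihr hr
    have hlr0 : (l.weight : ℝ) + r.weight ≠ 0 := by
      have := l.weight_pos
      positivity
    have hcl := hc l.weight (by simp [childWeights])
    have hcr := hc r.weight (by simp [childWeights])
    simp only [weight, Nat.cast_add] at hcl hcr hg
    constructor
    · rw [entropySurplus_node]
      rcases le_total r.weight l.weight with h | h
      · exact balance_nonneg_of_heavy_child hs hs1 hsb hD hchain h hcl
          (fun g hg' => hg g (List.mem_append_left _ hg')) hl0 hr0 hl1
      · have := balance_nonneg_of_heavy_child hs hs1 hsb hD hchain h (by rwa [add_comm])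
          (fun g hg' => by rw [add_comm]; exact hg g (List.mem_append_right _ hg')) hr0 hl0 hr1
        have hswap : (r.weight : ℝ) / (r.weight + l.weight) =
            1 - l.weight / (l.weight + r.weight) := by
          rw [one_sub_div hlr0, add_sub_cancel_left, add_comm]
        rw [hswap, Real.binEntropy_one_sub] at this
        linarith
    · rintro x y ⟨⟩
      rw [entropySurplus_node]
      linarith

end BTree

theorem gcb_external_path_length_upper_bound (α β : ℝ)
    (hα₁ : 1/2 ≤ α) (hα₂ : α ≤ 1) (hβ₁ : α/2 ≤ β) (hβ₂ : β ≤ α^2)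
    (hne : (α, β) ≠ (1, 1))
    (T : BTree) (hT : BTree.IsGCB α β T) :
    (T.epl : ℝ) ≤ ((T.numNodes : ℝ) + 1) * Real.logb 2 ((T.numNodes : ℝ) + 1)
      / ((H2 α + α * H2 (β / α)) / (1 + α)) := by
  have hα0 : 0 < α := by linarith
  have hβ0 : 0 < β := by linarith
  have hlog2 : 0 < Real.log 2 := Real.log_pos one_lt_two
  have hβα : β ≤ α := by nlinarith
  have hβ1 : β < 1 := by
    refine lt_of_le_of_ne (hβα.trans hα₂) fun h => hne ?_
    rw [Prod.mk.injEq]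
    exact ⟨by linarith, h⟩
  obtain ⟨s, hs_def⟩ : ∃ s, s = Real.sqrt β := ⟨_, rfl⟩
  have hs0 : 0 < s := hs_def ▸ Real.sqrt_pos.2 hβ0
  have hsb : s ^ 2 = β := hs_def ▸ Real.sq_sqrt hβ0.le
  have hsα : s ≤ α := by nlinarith
  have hs : 1 / 2 ≤ s := by nlinarith
  have hs1 : s < 1 := by nlinarith
  set E := Real.binEntropy α + α * Real.binEntropy (β / α) with hE
  obtain ⟨D, hD_def⟩ : ∃ D, D = E / (1 + α) := ⟨_, rfl⟩
  have hDE : (1 + α) * D = E := by rw [hD_def]; field_simp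
  have hΔ : (H2 α + α * H2 (β / α)) / (1 + α) = D / Real.log 2 := by
    rw [H2_eq_binEntropy_div, H2_eq_binEntropy_div, hD_def, hE]
    field_simp
  have hβα1 : β / α ≤ 1 := (div_le_one hα0).2 hβα
  have hE0 : 0 < E := by
    have h1 := Real.binEntropy_nonneg (div_pos hβ0 hα0).le hβα1
    rcases hα₂.eq_or_lt with rfl | hlt
    · have := Real.binEntropy_pos hβ0 hβ1
      rw [hE]
      simpa using this
    · have := Real.binEntropy_pos hα0 hlt
      positivity
  have hD0 : 0 < D := by rw [hD_def]; positivity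
  have hD : D ≤ Real.binEntropy s := by
    have := Real.binEntropy_add_mul_binEntropy_sq_div_le hs hs1 hsα hα₂
    rw [hsb, ← hE, ← hDE] at this
    exact le_of_mul_le_mul_left this (by linarith)
  have hβs : β ≤ s := by nlinarith
  have hchain : ∀ p, s ≤ p → p ≤ α →
      (1 + p) * D ≤ Real.binEntropy p + p * Real.binEntropy (β / p) := by
    intro p hsp hpα
    have h := (Real.concaveOn_negMulLog_split β D).min_le_of_mem_Icc (x := s) (y := α) (z := p)
      ⟨hβs, hs1.le⟩ ⟨hβα, hα₂⟩ ⟨hsp, hpα⟩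
    simp only [← Real.binEntropy_add_mul_binEntropy_div hβ0 (hβs.trans hsp),
      ← Real.binEntropy_add_mul_binEntropy_div hβ0 hβs,
      ← Real.binEntropy_add_mul_binEntropy_div hβ0 hβα] at h
    have hβs' : β / s = s := by rw [← hsb]; field_simp
    rw [hβs'] at h
    refine sub_nonneg.1 (le_trans (le_min ?_ ?_) h)
    · nlinarith
    · rw [hDE, hE, sub_self]
  have hmain := BTree.entropySurplus_nonneg hs hs1.le hsb hD hchain T hT
  rw [BTree.entropySurplus, BTree.weight_eq_numNodes_add_one] at hmain
  push_cast at hmain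
  rw [hΔ, Real.logb, le_div_iff₀ (by positivity), mul_div_assoc', mul_div_assoc']
  rw [div_le_div_iff_of_pos_right hlog2]
  linarith
end

section
/- Let α and β be real numbers with 2/3 ≤ β/α ≤ α < 3/4, and let Δ = (H₂(α) + α·H₂(β/α))/(1+α). For every integer N ≥ 0 there exists a GCB(α,β)-tree with N nodes whose height h satisfies h ≥ −2·log₂(N+1)/log₂(β) − 7 and whose external path length λ satisfies λ ≥ (N+1)·log₂(N+1)/Δ − 4N. -/
theorem BTree.weight_eq_numNodes_add_one_s4 (T : BTree) : T.weight = T.numNodes + 1 := by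
  induction T with
  | leaf => rfl
  | node l r hl hr => simp only [BTree.weight, BTree.numNodes]; omega

theorem two_mul_mul_one_sub_le_binEntropy {x : ℝ} (h₀ : 0 < x) (h₁ : x < 1) :
    2 * x * (1 - x) ≤ Real.binEntropy x := by
  have hx := Real.log_le_sub_one_of_pos h₀
  have hy := Real.log_le_sub_one_of_pos (sub_pos.2 h₁)
  simp only [Real.binEntropy, Real.log_inv]
  nlinarith [mul_le_mul_of_nonneg_left hx h₀.le, mul_le_mul_of_nonneg_left hy (sub_pos.2 h₁).le]

theorem three_eighths_le_binEntropy {x : ℝ} (h₀ : 2 / 3 ≤ x) (h₁ : x < 3 / 4) :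
    3 / 8 ≤ Real.binEntropy x := by
  have := two_mul_mul_one_sub_le_binEntropy (x := x) (by linarith) (by linarith)
  nlinarith

theorem log_sub_log_one_sub_le {x : ℝ} (h₀ : 2 / 3 ≤ x) (h₁ : x < 3 / 4) :
    Real.log x - Real.log (1 - x) ≤ 7 / 5 := by
  have hx : Real.log x ≤ 0 := Real.log_nonpos (by linarith) (by linarith)
  have hy : Real.log (1 / 4) ≤ Real.log (1 - x) := Real.log_le_log (by norm_num) (by linarith)
  have h4 : Real.log (1 / 4) = -(2 * Real.log 2) := by
    rw [show (1 / 4 : ℝ) = (2 ^ 2)⁻¹ by norm_num, Real.log_inv, Real.log_pow]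
    norm_num
  linarith [Real.log_two_lt_d9]

/-- The Gibbs inequality for a split of `m + l` into `m` and `l`, compared with the ratio `x`. -/
theorem add_mul_log_add_le {m l x : ℝ} (hm : 0 < m) (hl : 0 < l) (h₀ : 0 < x) (h₁ : x < 1) :
    (m + l) * Real.log (m + l) ≤ m * Real.log m + l * Real.log l
      + (m + l) * Real.binEntropy x
      + (x * (m + l) - m) * (Real.log x - Real.log (1 - x)) := by
  have key {a y : ℝ} (ha : 0 < a) (hy : 0 < y) :
      a * Real.log (m + l) ≤ a * Real.log a - a * Real.log y + (y * (m + l) - a) := by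
    have hb : 0 < m + l := by positivity
    have h := Real.log_le_sub_one_of_pos (show 0 < y * (m + l) / a by positivity)
    rw [Real.log_div (by positivity) ha.ne', Real.log_mul hy.ne' hb.ne'] at h
    have := mul_le_mul_of_nonneg_left h ha.le
    have e : a * (y * (m + l) / a - 1) = y * (m + l) - a := by field_simp
    rw [e] at this
    linarith
  have hm' := key hm h₀
  have hl' := key hl (sub_pos.2 h₁)
  simp only [Real.binEntropy, Real.log_inv]
  nlinarith

theorem exists_nat_floor_split {r : ℝ} (h₀ : 2 / 3 ≤ r) (h₁ : r < 3 / 4) {k : ℕ} (hk : 2 ≤ k) :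
    ∃ a b : ℕ, a + b = k ∧ 1 ≤ b ∧ b ≤ a ∧ (a : ℝ) ≤ r * k ∧ r * k < a + 1 := by
  have hk' : (2 : ℝ) ≤ k := by exact_mod_cast hk
  have hle : (⌊r * k⌋₊ : ℝ) ≤ r * k := Nat.floor_le (by positivity)
  have hlt := Nat.lt_floor_add_one (r * k)
  set a := ⌊r * k⌋₊
  have hlo : 2 * k < 3 * a + 3 := by
    have : (2 : ℝ) * k < 3 * a + 3 := by nlinarith
    exact_mod_cast this
  have hak : a < k := by
    have : (a : ℝ) < k := by nlinarith
    exact_mod_cast this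
  exact ⟨a, k - a, by omega, by omega, by omega, hle, hlt⟩

/-- The loss of one double step of the construction in the external path length estimate:
the ideal ratios `x`, `y` are rounded to the integer split of `c + d + l`. -/
theorem mul_log_le_of_split {x y D c d l : ℝ} (hx₀ : 2 / 3 ≤ x) (hx₁ : x < 3 / 4)
    (hy₀ : 2 / 3 ≤ y) (hy₁ : y < 3 / 4)
    (hD : D * (1 + x) = Real.binEntropy x + x * Real.binEntropy y)
    (hc : 0 < c) (hd : 0 < d) (hl : 0 < l)
    (hm : c + d ≤ x * (c + d + l)) (hm' : x * (c + d + l) < c + d + 1)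
    (hcy : c ≤ y * (c + d)) (hcy' : y * (c + d) < c + 1) :
    (c + d + l) * Real.log (c + d + l) ≤ c * Real.log c + d * Real.log d + l * Real.log l
      + (c + d + l + (c + d) + 8) * D := by
  have g₁ := add_mul_log_add_le (x := x) (add_pos hc hd) hl (by linarith) (by linarith)
  have g₂ := add_mul_log_add_le (x := y) hc hd (by linarith) (by linarith)
  have ex := three_eighths_le_binEntropy hx₀ hx₁
  have ey := three_eighths_le_binEntropy hy₀ hy₁
  have lx := log_sub_log_one_sub_le hx₀ hx₁
  have ly := log_sub_log_one_sub_le hy₀ hy₁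
  have hD' : 3 / 8 ≤ D := by nlinarith
  set Lx := Real.log x - Real.log (1 - x)
  set Ly := Real.log y - Real.log (1 - y)
  have t₂ : (y * (c + d) - c) * Ly ≤ 7 / 5 := by
    nlinarith [mul_le_mul_of_nonneg_left ly (sub_nonneg.2 hcy)]
  have t₁ : (x * (c + d + l) - (c + d)) * (Lx + D - Real.binEntropy y) ≤ 41 / 40 + D := by
    have : Lx + D - Real.binEntropy y ≤ 41 / 40 + D := by linarith
    nlinarith [mul_le_mul_of_nonneg_left this (sub_nonneg.2 hm)]
  have e : (c + d + l) * Real.binEntropy x + (c + d) * Real.binEntropy y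
      = (c + d + l + (c + d)) * D
        + (x * (c + d + l) - (c + d)) * (D - Real.binEntropy y) := by
    linear_combination (-(c + d + l)) * hD
  linarith

set_option maxHeartbeats 1000000 in
theorem exists_tree_of_weight {x y D : ℝ} (hx₀ : 2 / 3 ≤ x) (hx₁ : x < 3 / 4)
    (hy₀ : 2 / 3 ≤ y) (hyx : y ≤ x)
    (hD : D * (1 + x) = Real.binEntropy x + x * Real.binEntropy y) (n : ℕ) (hn : 1 ≤ n) :
    ∃ T : BTree, T.weight = n ∧ BTree.IsGCB x (x * y) T ∧
      (∀ c ∈ BTree.childWeights T, c ≤ x * n) ∧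
      ((n : ℝ) + 4) ^ 2 * (x * y) ^ (T.levels + 6) ≤ 1 ∧
      (n : ℝ) * Real.log n ≤ ((T.epl : ℝ) + 4 * (n - 1)) * D := by
  have hy₁ : y < 3 / 4 := by linarith
  have hβ₀ : 4 / 9 ≤ x * y := by nlinarith
  have hβ₁ : x * y ≤ 9 / 16 := by nlinarith
  have ex := three_eighths_le_binEntropy hx₀ hx₁
  have ey := three_eighths_le_binEntropy hy₀ hy₁
  have hD' : 3 / 8 ≤ D := by nlinarith
  induction n using Nat.strong_induction_on with
  | _ n ih =>
    obtain rfl | rfl | h3 : n = 1 ∨ n = 2 ∨ 3 ≤ n := by omega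
    · refine ⟨.leaf, rfl, trivial, ?_, ?_, ?_⟩
      · simp only [BTree.childWeights, List.mem_cons, List.not_mem_nil, or_false]
        rintro c (rfl | rfl) <;> norm_num <;> linarith
      · have := pow_le_pow_left₀ (by linarith) hβ₁ 6
        norm_num [BTree.levels] at this ⊢
        linarith
      · simp [BTree.epl]
    · refine ⟨.node .leaf .leaf, rfl, ?_, ?_, ?_, ?_⟩
      · simp only [BTree.IsGCB, BTree.childWeights, BTree.weight, List.mem_cons,
          List.mem_append, List.not_mem_nil, or_false, and_true]
        constructor
        · rintro c (rfl | rfl) <;> norm_num <;> linarith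
        · rintro c ((rfl | rfl) | (rfl | rfl)) <;> norm_num <;> linarith
      · simp only [BTree.childWeights, BTree.weight, List.mem_cons, List.not_mem_nil, or_false]
        rintro c (rfl | rfl) <;> norm_num <;> linarith
      · have := pow_le_pow_left₀ (by linarith) hβ₁ 7
        norm_num [BTree.levels] at this ⊢
        linarith
      · norm_num [BTree.epl, BTree.weight]
        linarith [Real.log_two_lt_d9]
    · obtain ⟨m, l, hml, hl₁, hlm, hmx, hmx'⟩ :=
        exists_nat_floor_split hx₀ hx₁ (show 2 ≤ n by omega)
      obtain ⟨c, d, hcd, hd₁, hdc, hcy, hcy'⟩ :=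
        exists_nat_floor_split hy₀ hy₁ (show 2 ≤ m by omega)
      obtain ⟨a, b, hab, -, hba, hay, -⟩ :=
        exists_nat_floor_split hy₀ hy₁ (show 2 ≤ n by omega)
      obtain ⟨T₁, w₁, g₁, cw₁, v₁, e₁⟩ := ih c (by omega) (by omega)
      obtain ⟨T₂, w₂, g₂, cw₂, -, e₂⟩ := ih d (by omega) (by omega)
      obtain ⟨T₃, w₃, g₃, cw₃, -, e₃⟩ := ih l (by omega) (by omega)
      subst hcd hml
      have hl₁' : (1 : ℝ) ≤ l := by exact_mod_cast hl₁
      have hd₁' : (1 : ℝ) ≤ d := by exact_mod_cast hd₁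
      have hdc' : (d : ℝ) ≤ c := by exact_mod_cast hdc
      have hlm' : (l : ℝ) ≤ c + d := by exact_mod_cast hlm
      have hly : (l : ℝ) ≤ y * (c + d + l) := by
        have h : (l : ℝ) ≤ a := by
          exact_mod_cast (show l ≤ a by omega)
        push_cast at hay
        linarith
      push_cast at hmx hmx' hcy hcy' ⊢
      have hcx : (c : ℝ) ≤ x * (c + d) := hcy.trans (by gcongr)
      have hcn : (c : ℝ) ≤ x * y * (c + d + l) := by nlinarith
      refine ⟨.node (.node T₁ T₂) T₃, by simp [BTree.weight, w₁, w₂, w₃], ?_, ?_, ?_, ?_⟩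
      · simp only [BTree.IsGCB, BTree.childWeights, BTree.weight, List.mem_cons,
          List.mem_append, List.not_mem_nil, or_false, w₁, w₂, w₃]
        push_cast
        refine ⟨?_, ?_, ⟨?_, ?_, g₁, g₂⟩, g₃⟩
        · rintro z (rfl | rfl) <;> linarith
        · rintro z ((rfl | rfl) | hz)
          · exact hcn
          · linarith
          · nlinarith [cw₃ z hz]
        · rintro z (rfl | rfl) <;> linarith
        · rintro z (hz | hz)
          · nlinarith [cw₁ z hz]
          · nlinarith [cw₂ z hz]
      · simp only [BTree.childWeights, BTree.weight, List.mem_cons, List.not_mem_nil, or_false,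
          w₁, w₂, w₃]
        push_cast
        rintro z (rfl | rfl) <;> linarith
      · have hlev : T₁.levels + 2 ≤ (BTree.node (.node T₁ T₂) T₃).levels := by
          simp only [BTree.levels]; omega
        have hstep : x * y * (c + d + l + 4 : ℝ) ≤ c + 4 := by nlinarith
        calc ((c : ℝ) + d + l + 4) ^ 2 * (x * y) ^ ((BTree.node (.node T₁ T₂) T₃).levels + 6)
            ≤ ((c : ℝ) + d + l + 4) ^ 2 * (x * y) ^ (T₁.levels + 2 + 6) := by
              gcongr ?_ * ?_
              exact pow_le_pow_of_le_one (by linarith) (by linarith) (by omega)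
          _ = (x * y * (c + d + l + 4 : ℝ)) ^ 2 * (x * y) ^ (T₁.levels + 6) := by ring
          _ ≤ ((c : ℝ) + 4) ^ 2 * (x * y) ^ (T₁.levels + 6) := by gcongr
          _ ≤ 1 := v₁
      · have := mul_log_le_of_split hx₀ hx₁ hy₀ hy₁ hD (c := c) (d := d) (l := l)
          (by linarith) (by linarith) (by linarith) hmx hmx' hcy hcy'
        simp only [BTree.epl, BTree.weight, w₁, w₂, w₃]
        push_cast
        linarith

theorem gcb_lower_bounds_tight (α β : ℝ)
    (h₁ : 2/3 ≤ β / α) (h₂ : β / α ≤ α) (h₃ : α < 3/4) :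
    ∀ N : ℕ, ∃ T : BTree, BTree.IsGCB α β T ∧ T.numNodes = N ∧
      -2 * Real.logb 2 ((N : ℝ) + 1) / Real.logb 2 β - 7 ≤ (T.levels : ℝ) - 1 ∧
      ((N : ℝ) + 1) * Real.logb 2 ((N : ℝ) + 1)
          / ((H2 α + α * H2 (β / α)) / (1 + α)) - 4 * (N : ℝ) ≤ (T.epl : ℝ) := by
  intro N
  have hx₀ : 2 / 3 ≤ α := h₁.trans h₂
  have hα : α ≠ 0 := by linarith
  have hβ : β = α * (β / α) := by field_simp
  have hlog2 : 0 < Real.log 2 := Real.log_pos (by norm_num)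
  set y := β / α
  set D := (Real.binEntropy α + α * Real.binEntropy y) / (1 + α) with hDdef
  have hD : D * (1 + α) = Real.binEntropy α + α * Real.binEntropy y :=
    div_mul_cancel₀ _ (by linarith)
  have hDpos : 0 < D := by
    have := three_eighths_le_binEntropy hx₀ h₃
    have := three_eighths_le_binEntropy h₁ (h₂.trans_lt h₃)
    exact div_pos (by nlinarith) (by linarith)
  have hΔ : (H2 α + α * H2 y) / (1 + α) = D / Real.log 2 := by
    rw [H2_eq_binEntropy_div, H2_eq_binEntropy_div, hDdef]
    ring
  have hβ₀ : 0 < β := by rw [hβ]; nlinarith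
  have hβ₁ : β < 1 := by rw [hβ]; nlinarith
  obtain ⟨T, hw, hg, -, hlev, hepl⟩ :=
    exists_tree_of_weight hx₀ h₃ h₁ h₂ hD (N + 1) (by omega)
  rw [← hβ] at hg hlev
  push_cast at hlev hepl
  refine ⟨T, hg, by have := T.weight_eq_numNodes_add_one_s4; omega, ?_, ?_⟩
  · have hlogβ : Real.log β < 0 := Real.log_neg hβ₀ hβ₁
    have h := Real.log_nonpos (by positivity) hlev
    rw [Real.log_mul (by positivity) (by positivity), Real.log_pow, Real.log_pow] at h
    push_cast at h
    have hmono : Real.log ((N : ℝ) + 1) ≤ Real.log ((N : ℝ) + 1 + 4) :=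
      Real.log_le_log (by positivity) (by linarith)
    have e : -2 * Real.logb 2 ((N : ℝ) + 1) / Real.logb 2 β
        = -2 * Real.log ((N : ℝ) + 1) / Real.log β := by
      simp only [Real.logb]
      field_simp
    have : -2 * Real.log ((N : ℝ) + 1) / Real.log β ≤ T.levels + 6 := by
      rw [div_le_iff_of_neg hlogβ]
      linarith
    linarith
  · have e : ((N : ℝ) + 1) * Real.logb 2 ((N : ℝ) + 1) / (D / Real.log 2)
        = ((N : ℝ) + 1) * Real.log ((N : ℝ) + 1) / D := by
      simp only [Real.logb]
      field_simp
    rw [hΔ, e, sub_le_iff_le_add, div_le_iff₀ hDpos]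
    linarith
end

section
/- Let α_c = 1/√2 and β_c = (√(1+4·α_c) − 1)/2. Every GCB(α_c, β_c)-tree with N nodes has external path length λ ≤ 1.1271·(N+1)·log₂(N+1). -/
open Real in
/-- Lower bound on `negMulLog p` in terms of a comparison point `q`, with `-log q` estimated by a
rational multiple of `log 2`. -/
lemma mul_log_two_sub_le_negMulLog {p q : ℝ} (hp : 0 < p) (hq : 0 < q) (m n : ℕ) (hn : 0 < n)
    (h : q ^ n * 2 ^ m ≤ 1) :
    p * (m / n * log 2) - p * (p - q) / q ≤ negMulLog p := by
  have hn' : (0 : ℝ) < n := by exact_mod_cast hn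
  have hlogq : log q ≤ -(m / n * log 2) := by
    have := log_nonpos (by positivity) h
    rw [log_mul (by positivity) (by positivity), log_pow, log_pow] at this
    rw [div_mul_eq_mul_div, ← neg_div, le_div_iff₀ hn']
    linarith
  have hlogp : log p ≤ log q + (p - q) / q := by
    have := log_le_sub_one_of_pos (div_pos hp hq)
    rw [log_div hp.ne' hq.ne'] at this
    have e : p / q - 1 = (p - q) / q := by field_simp
    linarith
  have := mul_le_mul_of_nonneg_left (hlogp.trans (add_le_add_left hlogq _)) hp.le
  rw [negMulLog]
  have e : p * (p - q) / q = p * ((p - q) / q) := by ring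
  rw [e]
  linarith

open Real in
/-- The chain rule for the entropy of the partition of `[0, 1]` into parts `b`, `y - b`, `1 - y`. -/
lemma binEntropy_add_mul_binEntropy_div {b y : ℝ} (hb : 0 < b) (hby : b < y) :
    binEntropy y + y * binEntropy (b / y) = negMulLog b + negMulLog (y - b) + negMulLog (1 - y) := by
  have hy : 0 < y := hb.trans hby
  have e : 1 - b / y = (y - b) / y := by field_simp
  rw [binEntropy_eq_negMulLog_add_negMulLog_one_sub, binEntropy_eq_negMulLog_add_negMulLog_one_sub,
    e]
  simp only [negMulLog]
  rw [log_div hb.ne' hy.ne', log_div (sub_pos.2 hby).ne' hy.ne']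
  field_simp
  ring

open Real in
lemma log_two_le_mul_binEntropy {y : ℝ} (h₁ : 1 / 2 ≤ y) (h₂ : y ≤ 0.69) :
    log 2 ≤ 1.1271 * binEntropy y := by
  have h : binEntropy 0.69 ≤ binEntropy y :=
    binEntropy_strictAntiOn.antitoneOn ⟨by linarith, by linarith⟩ ⟨by norm_num, by norm_num⟩ h₂
  rw [binEntropy_eq_negMulLog_add_negMulLog_one_sub] at h
  have k₁ := mul_log_two_sub_le_negMulLog (p := 0.69) (q := 0.69) (by norm_num) (by norm_num)
    38 71 (by norm_num) (by norm_num)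
  have k₂ := mul_log_two_sub_le_negMulLog (p := 1 - 0.69) (q := 0.31) (by norm_num) (by norm_num)
    49 29 (by norm_num) (by norm_num)
  norm_num at h k₁ k₂ ⊢
  linarith [log_pos one_lt_two]

set_option exponentiation.threshold 1000 in
open Real in
lemma one_add_mul_log_two_le_mul_binEntropy {y : ℝ} (h₁ : 0.69 ≤ y) (h₂ : y ≤ 0.70711) :
    (1 + y) * log 2 ≤ 1.1271 * (binEntropy y + y * binEntropy (0.47832 / y)) := by
  rw [binEntropy_add_mul_binEntropy_div (by norm_num) (by linarith)]
  have k₁ := mul_log_two_sub_le_negMulLog (p := 0.47832) (q := 0.47832) (by norm_num)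
    (by norm_num) 416 391 (by norm_num) (by norm_num)
  have k₂ := mul_log_two_sub_le_negMulLog (p := y - 0.47832) (q := 0.22879) (by linarith)
    (by norm_num) 649 305 (by norm_num) (by norm_num)
  have k₃ := mul_log_two_sub_le_negMulLog (p := 1 - y) (q := 0.29289) (by linarith)
    (by norm_num) 411 232 (by norm_num) (by norm_num)
  have hL := log_two_gt_d9
  norm_num at k₁ k₂ k₃ ⊢
  have hy : 0 ≤ (y - 0.69) * (0.70711 - y) := mul_nonneg (by linarith) (by linarith)
  have hyL : 0 ≤ (0.70711 - y) * (log 2 - 0.6931471803) :=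
    mul_nonneg (by linarith) (by linarith)
  norm_num at hy hyL
  linarith

namespace BTree

open Real

lemma weight_pos_s6 (T : BTree) : 0 < T.weight := by
  induction T with
  | leaf => simp [weight]
  | node l r hl hr => simp only [weight]; omega

lemma weight_eq_numNodes_add_one_s6 (T : BTree) : T.weight = T.numNodes + 1 := by
  induction T with
  | leaf => rfl
  | node l r hl hr => simp only [weight, numNodes]; omega

/-- The amount, in natural units, by which the external path length of a tree falls short of
`1.1271 * |T| * log₂ |T|`. -/
noncomputable def eplGap (T : BTree) : ℝ :=
  1.1271 * (T.weight * log T.weight) - T.epl * log 2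

lemma eplGap_node (l r : BTree) :
    eplGap (node l r) = eplGap l + eplGap r +
      (l.weight + r.weight) * (1.1271 * binEntropy (l.weight / (l.weight + r.weight)) - log 2) := by
  have hl : (0 : ℝ) < l.weight := by exact_mod_cast l.weight_pos_s6
  have hr : (0 : ℝ) < r.weight := by exact_mod_cast r.weight_pos_s6
  have e : 1 - (l.weight : ℝ) / (l.weight + r.weight) = r.weight / (l.weight + r.weight) := by
    field_simp
    ring
  rw [binEntropy_eq_negMulLog_add_negMulLog_one_sub, e]
  simp only [eplGap, weight, epl, negMulLog]
  push_cast
  rw [log_div hl.ne' (by positivity), log_div hr.ne' (by positivity)]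
  field_simp
  ring

lemma binEntropy_weight_comm (l r : BTree) :
    binEntropy (l.weight / (l.weight + r.weight)) =
      binEntropy (r.weight / (l.weight + r.weight)) := by
  have hl : (0 : ℝ) < l.weight := by exact_mod_cast l.weight_pos_s6
  have hr : (0 : ℝ) < r.weight := by exact_mod_cast r.weight_pos_s6
  rw [← binEntropy_one_sub]
  congr 1
  field_simp
  ring

/-- If a node is split so unevenly that its entropy is too small, then the gap of its heavier child
`l` makes up for the loss. -/
lemma le_eplGap_heavier_child {l : BTree} {w : ℝ} (hl₁ : w / 2 ≤ l.weight)
    (hl₂ : l.weight ≤ 0.70711 * w) (hl₀ : l = leaf → w = 2)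
    (hg : ∀ g ∈ childWeights l, g ≤ 0.47832 * w) (hgap : 0 ≤ eplGap l)
    (hnode : ∀ a b, l = node a b →
      l.weight * (1.1271 * binEntropy (a.weight / l.weight) - log 2) ≤ eplGap l) :
    w * (log 2 - 1.1271 * binEntropy (l.weight / w)) ≤ eplGap l := by
  have hl : (0 : ℝ) < l.weight := by exact_mod_cast l.weight_pos_s6
  have hw : 0 < w := by linarith
  set y : ℝ := l.weight / w with hy
  have hly : (l.weight : ℝ) = y * w := by rw [hy]; field_simp
  have hy₁ : 1 / 2 ≤ y := by rw [hy, le_div_iff₀ hw]; linarith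
  have hy₂ : y ≤ 0.70711 := by rwa [hy, div_le_iff₀ hw]
  rcases le_or_gt y 0.69 with hy₃ | hy₃
  · have := log_two_le_mul_binEntropy hy₁ hy₃
    nlinarith
  match l, hl₀, hnode with
  | leaf, hl₀, _ =>
    rw [hl₀ rfl] at hly
    norm_num [weight] at hly
    linarith
  | node a b, _, hnode =>
    have ha : (a.weight : ℝ) ≤ 0.47832 * w := hg _ (by simp [childWeights])
    have hb : (b.weight : ℝ) ≤ 0.47832 * w := hg _ (by simp [childWeights])
    have hab : ((node a b).weight : ℝ) = a.weight + b.weight := by simp [weight]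
    have heavy : ∀ c : ℝ, c ≤ 0.47832 * w → 1 / 2 ≤ c / (node a b).weight →
        binEntropy (0.47832 / y) ≤ binEntropy (c / (node a b).weight) := by
      intro c hc hc'
      have hle : c / (node a b).weight ≤ 0.47832 / y := by
        rw [hly, div_le_div_iff₀ (by positivity) (by linarith)]
        nlinarith
      have hone : 0.47832 / y ≤ 1 := by rw [div_le_one (by linarith)]; linarith
      exact binEntropy_strictAntiOn.antitoneOn ⟨by linarith, by linarith⟩
        ⟨by linarith, hone⟩ hle
    have hent : binEntropy (0.47832 / y) ≤ binEntropy (a.weight / (node a b).weight) := by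
      rcases le_total (1 / 2) ((a.weight : ℝ) / (node a b).weight) with h | h
      · exact heavy _ ha h
      · rw [hab, binEntropy_weight_comm, ← hab]
        refine heavy _ hb ?_
        rw [div_le_iff₀ hl] at h
        rw [le_div_iff₀ hl]
        linarith
    have hsum := one_add_mul_log_two_le_mul_binEntropy hy₃.le hy₂
    refine le_trans ?_ (hnode a b rfl)
    rw [hly] at hent ⊢
    have h₁ : y * binEntropy (0.47832 / y) ≤ y * binEntropy (a.weight / (y * w)) :=
      mul_le_mul_of_nonneg_left hent (by linarith)
    have h₂ : log 2 - 1.1271 * binEntropy y ≤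
        y * (1.1271 * binEntropy (a.weight / (y * w)) - log 2) := by linarith
    have := mul_le_mul_of_nonneg_left h₂ hw.le
    linarith

lemma eplGap_nonneg_of_isGCB {α β : ℝ} (hα : α ≤ 0.70711) (hβ : β ≤ 0.47832) (T : BTree)
    (hT : T.IsGCB α β) :
    0 ≤ eplGap T ∧ ∀ a b, T = node a b →
      T.weight * (1.1271 * binEntropy (a.weight / T.weight) - log 2) ≤ eplGap T := by
  induction T with
  | leaf => simp [eplGap, weight, epl]
  | node l r ihl ihr =>
    obtain ⟨hc, hg, hTl, hTr⟩ := hT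
    obtain ⟨hl, hl'⟩ := ihl hTl
    obtain ⟨hr, hr'⟩ := ihr hTr
    have hwl : (1 : ℝ) ≤ l.weight := by exact_mod_cast l.weight_pos_s6
    have hwr : (1 : ℝ) ≤ r.weight := by exact_mod_cast r.weight_pos_s6
    have hw : ((node l r).weight : ℝ) = l.weight + r.weight := by simp [weight]
    have hgap := eplGap_node l r
    refine ⟨?_, ?_⟩
    · have hαw : α * (l.weight + r.weight) ≤ 0.70711 * (l.weight + r.weight) :=
        mul_le_mul_of_nonneg_right hα (by linarith)
      have hβw : β * (l.weight + r.weight) ≤ 0.47832 * (l.weight + r.weight) :=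
        mul_le_mul_of_nonneg_right hβ (by linarith)
      have hcl : (l.weight : ℝ) ≤ α * (node l r).weight := hc _ (by simp [childWeights])
      have hcr : (r.weight : ℝ) ≤ α * (node l r).weight := hc _ (by simp [childWeights])
      rw [hw] at hcl hcr hg
      rcases le_total (r.weight : ℝ) l.weight with h | h
      · have := le_eplGap_heavier_child (l := l) (w := l.weight + r.weight) (by linarith)
          (hcl.trans hαw)
          (by
            rintro rfl
            simp only [weight, Nat.cast_one] at h ⊢
            linarith)
          (fun g hgl => (hg g (List.mem_append_left _ hgl)).trans hβw) hl hl'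
        linarith
      · have := le_eplGap_heavier_child (l := r) (w := l.weight + r.weight) (by linarith)
          (hcr.trans hαw)
          (by
            rintro rfl
            simp only [weight, Nat.cast_one] at h ⊢
            linarith)
          (fun g hgr => (hg g (List.mem_append_right _ hgr)).trans hβw) hr hr'
        rw [binEntropy_weight_comm] at hgap
        linarith
    · intro a b hab
      obtain ⟨rfl, rfl⟩ := node.inj hab
      rw [hw]
      linarith

end BTree

lemma one_div_sqrt_two_le : 1 / Real.sqrt 2 ≤ 0.7071068 := by
  rw [div_le_iff₀ (by positivity)]
  have : (1.41421356 : ℝ) ≤ Real.sqrt 2 := Real.le_sqrt_of_sq_le (by norm_num)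
  linarith

theorem gcb_critical_epl_bound
    (T : BTree)
    (hT : BTree.IsGCB (1 / Real.sqrt 2) ((Real.sqrt (1 + 4 * (1 / Real.sqrt 2)) - 1) / 2) T) :
    (T.epl : ℝ) ≤ 1.1271 * ((T.numNodes : ℝ) + 1) * Real.logb 2 ((T.numNodes : ℝ) + 1) := by
  have hα := one_div_sqrt_two_le
  have hβ : Real.sqrt (1 + 4 * (1 / Real.sqrt 2)) ≤ 1.95664 := by
    rw [Real.sqrt_le_left (by norm_num)]
    linarith
  have h := (BTree.eplGap_nonneg_of_isGCB (by linarith) (by linarith) T hT).1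
  rw [BTree.eplGap, BTree.weight_eq_numNodes_add_one_s6] at h
  push_cast at h
  rw [Real.logb, mul_div_assoc', le_div_iff₀ (Real.log_pos one_lt_two)]
  linarith
end

section
/- Let α be a real number with 1/√2 ≤ α < 3/4 and set α̂ = (1 + α − √((1−α)(5−α)))/(2(2α−1)). Then 1/√2 ≤ α̂ ≤ α. -/
theorem alphaHat_bounds (α : ℝ) (h₁ : 1 / Real.sqrt 2 ≤ α) (h₂ : α < 3/4) :
    1 / Real.sqrt 2 ≤ (1 + α - Real.sqrt ((1 - α) * (5 - α))) / (2 * (2 * α - 1)) ∧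
    (1 + α - Real.sqrt ((1 - α) * (5 - α))) / (2 * (2 * α - 1)) ≤ α := by
  have ht : Real.sqrt 2 ^ 2 = 2 := Real.sq_sqrt (by norm_num)
  have ht_pos : 0 < Real.sqrt 2 := by positivity
  have h_inv : 1 / Real.sqrt 2 = Real.sqrt 2 / 2 := by
    field_simp
    linarith
  rw [h_inv] at h₁ ⊢
  generalize Real.sqrt 2 = t at *
  have ht_one : 1 < t := by nlinarith
  have ht_lt : t < 3 / 2 := by linarith
  have hα : 0 < 2 * α - 1 := by linarith
  constructor
  · rw [le_div_iff₀ (by linarith)]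
    have hs : Real.sqrt ((1 - α) * (5 - α)) ≤ 1 + α - t * (2 * α - 1) := by
      refine Real.sqrt_le_iff.mpr ⟨by nlinarith, ?_⟩
      have h_nonneg : 0 ≤ (2 * α - 1) * ((4 - 2 * t) * (α - t / 2)) :=
        mul_nonneg hα.le (mul_nonneg (by linarith) (by linarith))
      linear_combination h_nonneg - (2 * α - 1) * (2 * α - 2) * ht
    linarith
  · rw [div_le_iff₀ (by linarith)]
    have hs : 1 + 3 * α - 4 * α ^ 2 ≤ Real.sqrt ((1 - α) * (5 - α)) := by
      refine Real.le_sqrt_of_sq_le ?_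
      have h_sq : 0 ≤ 2 * α ^ 2 - 1 := by nlinarith
      have h_nonneg : 0 ≤ 4 * (2 * α - 1) * ((1 - α) * (2 * α ^ 2 - 1)) :=
        mul_nonneg (by linarith) (mul_nonneg (by linarith) h_sq)
      linear_combination h_nonneg
    linarith
end

section
/- Let α be a real number with 1/√2 ≤ α < 3/4, set α̂ = (1 + α − √((1−α)(5−α)))/(2(2α−1)) and α• = 19/24. Then all of the following hold: (i) α·α• < α̂; (ii) (1−α̂)·(α•−1+α̂) < α̂·(1−α•); (iii) (1−α̂)² < α̂²·(1−α); (iv) (1−α̂)·α² < α̂·(1−α); (v) (1−α̂)·(1−α) + α·α• < α̂; (vi) (1−α̂)·α²·α• < α̂·(1−α•); (vii) 1 + (α²−1)·α̂ < α̂. -/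
theorem alphaHat_inequalities (α : ℝ) (h₁ : 1 / Real.sqrt 2 ≤ α) (h₂ : α < 3/4) :
    let αh : ℝ := (1 + α - Real.sqrt ((1 - α) * (5 - α))) / (2 * (2 * α - 1))
    let αb : ℝ := 19/24
    α * αb < αh ∧
    (1 - αh) * (αb - 1 + αh) < αh * (1 - αb) ∧
    (1 - αh)^2 < αh^2 * (1 - α) ∧
    (1 - αh) * α^2 < αh * (1 - α) ∧
    (1 - αh) * (1 - α) + α * αb < αh ∧
    (1 - αh) * α^2 * αb < αh * (1 - αb) ∧
    1 + (α^2 - 1) * αh < αh := by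
  intro αh αb
  have hα : 7071 / 10000 ≤ α := by
    refine le_trans ?_ h₁
    rw [le_div_iff₀ (by positivity)]
    have : √2 ≤ 141422 / 100000 := Real.sqrt_le_iff.2 (by norm_num)
    linarith
  have hd : 0 < 2 * (2 * α - 1) := by linarith
  have hlo : 7067 / 10000 ≤ αh := by
    have : √((1 - α) * (5 - α)) ≤ 1 + α - 7067 / 10000 * (2 * (2 * α - 1)) :=
      Real.sqrt_le_iff.2 ⟨by linarith, by nlinarith⟩
    rw [le_div_iff₀ hd]
    linarith
  have hhi : αh ≤ 3 / 4 := by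
    have : 1 + α - 3 / 4 * (2 * (2 * α - 1)) ≤ √((1 - α) * (5 - α)) :=
      Real.le_sqrt_of_sq_le (by nlinarith)
    rw [div_le_iff₀ hd]
    linarith
  have hb : αb = 19 / 24 := rfl
  clear_value αh αb
  subst hb
  have hsq : α ^ 2 ≤ 9 / 16 := by nlinarith
  have hprod : (1 - αh) * α ^ 2 ≤ 2933 / 10000 * (9 / 16) :=
    mul_le_mul (by linarith) hsq (sq_nonneg α) (by norm_num)
  refine ⟨by linarith, by nlinarith, ?_, ?_, by nlinarith, by linarith, by nlinarith⟩
  · have h₃ : (1 - αh) ^ 2 ≤ (2933 / 10000) ^ 2 :=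
      pow_le_pow_left₀ (by linarith) (by linarith) 2
    have h₄ : (7067 / 10000) ^ 2 * (1 / 4) ≤ αh ^ 2 * (1 - α) := by
      gcongr
      linarith
    linarith
  · have : 7067 / 10000 * (1 / 4) ≤ αh * (1 - α) := by
      gcongr
      linarith
    linarith
end

section
/- Let α and β be real numbers with 1/√2 ≤ α < 3/4 and ℬ(α) ≤ β ≤ α², where ℬ(α) = (√(1+4α) − 1)/2, and set β̂ = α·(1 + α − √((1−α)² + 4α(α²−β)))/(2(1−α²+β)). Then 1/4 < β̂ ≤ β and α < 2·β̂. -/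
theorem betaHat_bounds (α β : ℝ) (h₁ : 1 / Real.sqrt 2 ≤ α) (h₂ : α < 3/4)
    (h₃ : (Real.sqrt (1 + 4 * α) - 1) / 2 ≤ β) (h₄ : β ≤ α^2) :
    let βh : ℝ := α * (1 + α - Real.sqrt ((1 - α)^2 + 4 * α * (α^2 - β)))
      / (2 * (1 - α^2 + β))
    1/4 < βh ∧ βh ≤ β ∧ α < 2 * βh := by
  intro βh
  have hα : 7 / 10 < α := by
    refine lt_of_lt_of_le ?_ h₁
    rw [lt_div_iff₀ (by positivity)]
    have : Real.sqrt 2 < 10 / 7 := by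
      rw [Real.sqrt_lt' (by norm_num)]
      norm_num
    linarith
  have hsq : Real.sqrt (1 + 4 * α) ≤ 2 * β + 1 := by linarith
  have hβ₀ : 0 < β := by
    have : 1 < Real.sqrt (1 + 4 * α) := Real.lt_sqrt_of_sq_lt (by linarith)
    linarith
  have hβ : α ≤ β ^ 2 + β := by
    have := (Real.sqrt_le_left (by linarith)).1 hsq
    linarith
  have hβ₁ : (1 - α) ^ 2 < β := by
    have : 3 / 10 < β := by nlinarith
    nlinarith
  have hc : 0 < 1 - α ^ 2 + β := by nlinarith
  have hupper : βh ≤ β := by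
    have habs : α * (1 + α) - 2 * (1 - α ^ 2 + β) * β
        ≤ α * Real.sqrt ((1 - α) ^ 2 + 4 * α * (α ^ 2 - β)) := by
      have hD : 0 ≤ (1 - α) ^ 2 + 4 * α * (α ^ 2 - β) := by
        have := mul_nonneg (by linarith : 0 ≤ 4 * α) (sub_nonneg.2 h₄)
        positivity
      refine (abs_le_of_sq_le_sq' ?_ (by positivity)).2
      rw [mul_pow, Real.sq_sqrt hD]
      have := mul_nonneg hc.le (mul_nonneg (sub_nonneg.2 h₄) (sub_nonneg.2 hβ))
      linarith
    rw [div_le_iff₀ (by positivity)]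
    linarith
  have hlower : α < 2 * βh := by
    have hs : Real.sqrt ((1 - α) ^ 2 + 4 * α * (α ^ 2 - β)) < α + α ^ 2 - β := by
      rw [Real.sqrt_lt' (by linarith)]
      have := mul_pos hc (sub_pos.2 hβ₁)
      linarith
    have : α / 2 < βh := by
      rw [lt_div_iff₀ (by positivity)]
      have := mul_lt_mul_of_pos_left hs (by linarith : 0 < α)
      linarith
    linarith
  exact ⟨by linarith, hupper, hlower⟩
end

section
/- Let α and β be real numbers with 1/√2 ≤ α < 3/4 and ℬ(α) ≤ β ≤ α², where ℬ(α) = (√(1+4α) − 1)/2. Set α̂ = (1 − 2α + 6α² − √((1−α)(5−α)))/(5(2α−1)), β̂ = α·(1 + α − √((1−α)² + 4α(α²−β)))/(2(1−α²+β)), γ̂ = β̂/α, and δ = min{α̂, γ̂}. Then all of the following hold: (i) α² < δ; (ii) (1−δ)(α−β̂) < δ(1−α); (iii) (1−δ)(1−γ̂) ≤ δ·γ̂·(1−α); (iv) 1−β̂ < δ; (v) (1−δ)(α−β̂) < δ(β̂−αβ); (vi) (1−δ)·β < δ(1−α); (vii) α − β̂ + αβ < δ; (viii) (1−δ)·αβ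 < δ(1−α); (ix) 1 ≤ δ(1+β); (x) 1 − δ + (δ + βδ − 1)·α ≤ δ·β̂; (xi) 1 + (β−1)·γ̂ < δ. -/
/-- The smaller root `g` of `(1 - α² + β) g² - (1 + α) g + α` satisfies `1 ≤ g (1 + β)` and
`g ≤ α` when `α ≤ β² + β` and `β ≤ α²`. -/
theorem smaller_root_bounds {α β g : ℝ} (hα : 7 / 10 < α) (hα' : α < 3 / 4)
    (hβ : 2 / 5 < β) (hβ' : β ≤ α ^ 2) (hαβ : α ≤ β ^ 2 + β)
    (hg : g = (1 + α - √((1 - α) ^ 2 + 4 * α * (α ^ 2 - β))) / (2 * (1 - α ^ 2 + β))) :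
    (1 - α ^ 2 + β) * g ^ 2 - (1 + α) * g + α = 0 ∧ 1 ≤ g * (1 + β) ∧ g ≤ α := by
  have hK : 0 < 1 - α ^ 2 + β := by nlinarith
  have hnn : 0 ≤ (1 - α) ^ 2 + 4 * α * (α ^ 2 - β) := by
    have := mul_nonneg (by linarith : 0 ≤ 4 * α) (sub_nonneg.2 hβ')
    positivity
  have hsq := Real.sq_sqrt hnn
  set R := √((1 - α) ^ 2 + 4 * α * (α ^ 2 - β)) with hR
  have hgR : 2 * (1 - α ^ 2 + β) * g = 1 + α - R := by
    rw [hg]; field_simp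
  refine ⟨?_, ?_, ?_⟩
  · have hR' : R = 1 + α - 2 * (1 - α ^ 2 + β) * g := by linarith
    rw [hR'] at hsq
    have : (1 - α ^ 2 + β) * ((1 - α ^ 2 + β) * g ^ 2 - (1 + α) * g + α) = 0 := by
      linear_combination hsq / 4
    exact (mul_eq_zero.1 this).resolve_left hK.ne'
  · have hRle : R ≤ 1 + α - 2 * (1 - α ^ 2 + β) / (1 + β) := by
      rw [hR, Real.sqrt_le_iff]
      have h1 : 0 < 1 + β := by linarith
      constructor
      · rw [sub_nonneg, div_le_iff₀ h1]; nlinarith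
      · have h2 : (1 + α - 2 * (1 - α ^ 2 + β) / (1 + β)) ^ 2 -
            ((1 - α) ^ 2 + 4 * α * (α ^ 2 - β)) =
            4 * (1 - α ^ 2 + β) * α * (β ^ 2 + β - α) / (1 + β) ^ 2 := by
          field_simp; ring
        have h3 : 0 ≤ 4 * (1 - α ^ 2 + β) * α * (β ^ 2 + β - α) / (1 + β) ^ 2 := by
          have := sub_nonneg.2 hαβ
          have : 0 ≤ α := by linarith
          positivity
        linarith
    have h1 : 0 < 1 + β := by linarith
    have h2 : 2 * (1 - α ^ 2 + β) * (1 / (1 + β)) ≤ 2 * (1 - α ^ 2 + β) * g := by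
      rw [mul_one_div]; linarith
    exact (div_le_iff₀ h1).1 (le_of_mul_le_mul_left h2 (by positivity))
  · have hRge : 1 - α + 2 * α * (α ^ 2 - β) ≤ R := by
      apply Real.le_sqrt_of_sq_le
      have hu := sub_nonneg.2 hβ'
      have hu' : α ^ 2 - β ≤ 1 := by nlinarith
      have : 0 ≤ 4 * α ^ 2 * (α ^ 2 - β) * (1 - (α ^ 2 - β)) := by
        have := sub_nonneg.2 hu'
        positivity
      linarith
    refine le_of_mul_le_mul_left (a := 2 * (1 - α ^ 2 + β)) ?_ (by positivity)
    linarith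

/-- A linear lower bound for `α̂` on the whole range of `α`. -/
theorem linear_le_alpha_hat {α : ℝ} (hα : 7 / 10 < α) (hα' : α < 3 / 4) :
    7 / 10 * α + 21 / 100 ≤
      (1 - 2 * α + 6 * α ^ 2 - √((1 - α) * (5 - α))) / (5 * (2 * α - 1)) := by
  rw [le_div_iff₀ (by linarith)]
  have : √((1 - α) * (5 - α)) ≤
      1 - 2 * α + 6 * α ^ 2 - (7 / 10 * α + 21 / 100) * (5 * (2 * α - 1)) := by
    rw [Real.sqrt_le_iff]
    constructor
    · nlinarith
    · nlinarith [mul_pos (sub_pos.2 hα) (sub_pos.2 hα')]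
  linarith

/-- The balancing inequalities when the minimum `δ` is attained by `γ̂ = g`. -/
theorem balancing_of_eq {α β g : ℝ} (hα : 7071 / 10000 < α) (hα' : α < 3 / 4)
    (hβ : 19 / 40 < β) (hβ' : β ≤ α ^ 2)
    (hq : (1 - α ^ 2 + β) * g ^ 2 - (1 + α) * g + α = 0) (hg1 : 1 ≤ g * (1 + β)) (hgα : g ≤ α) :
    α ^ 2 < g ∧
    (1 - g) * (α - α * g) < g * (1 - α) ∧
    (1 - g) * (1 - g) ≤ g * g * (1 - α) ∧
    1 - α * g < g ∧
    (1 - g) * (α - α * g) < g * (α * g - α * β) ∧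
    (1 - g) * β < g * (1 - α) ∧
    α - α * g + α * β < g ∧
    (1 - g) * (α * β) < g * (1 - α) ∧
    1 ≤ g * (1 + β) ∧
    1 - g + (g + β * g - 1) * α ≤ g * (α * g) ∧
    1 + (β - 1) * g < g := by
  have hg0 : 0 < g := by nlinarith
  have hE : 0 ≤ α * g ^ 2 + g - 1 := by
    have h : α * (α * g ^ 2 + g - 1) = g * (g * (1 + β) - 1) := by linear_combination -hq
    have h' : 0 ≤ α * (α * g ^ 2 + g - 1) := by
      rw [h]; exact mul_nonneg hg0.le (by linarith)
    exact nonneg_of_mul_nonneg_right h' (by linarith)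
  have hg : 2 / 3 < g := by
    have h : 0 < (3 * g - 2) * (g + 2) := by
      nlinarith [mul_pos (sub_pos.2 hα') (pow_pos hg0 2)]
    linarith [pos_of_mul_pos_left h (by linarith)]
  have hβg : β * g ^ 2 = α ^ 2 * g ^ 2 - (1 - g) * (α - g) := by linear_combination hq
  have of_mul {x y : ℝ} (h : g ^ 2 * x < g ^ 2 * y) : x < y :=
    lt_of_mul_lt_mul_left h (by positivity)
  have hslope : 0 < g ^ 2 * (α + 3 / 4) - (1 - g) := by
    nlinarith [pow_pos hg0 2]
  have hgβ_lt : g * β < 2 * g - 1 := by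
    apply of_mul
    have h₁ : 0 < (3 / 4 - α) * (g ^ 2 * (α + 3 / 4) - (1 - g)) :=
      mul_pos (by linarith) hslope
    have h₂ : 0 < (3 * g - 2) * (13 * g - 6) := mul_pos (by linarith) (by linarith)
    have h : 0 < g * (2 * g ^ 2 - g - (α ^ 2 * g ^ 2 - (1 - g) * (α - g))) :=
      mul_pos hg0 (by linarith)
    linear_combination h + g * hβg
  have h_share : (1 - g) * β < g * (1 - α) := by
    apply of_mul
    have h₁ : 0 < (3 / 4 - α) * ((1 - g) * (g ^ 2 * (α + 3 / 4) - (1 - g)) + g ^ 3) :=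
      mul_pos (by linarith)
        (add_pos (mul_pos (by linarith) hslope) (by positivity))
    have h₂ : 0 < (3 * g - 2) * (11 * g - g ^ 2 - 6) := mul_pos (by linarith) (by nlinarith)
    linear_combination h₁ + h₂ / 16 + (1 - g) * hβg
  refine ⟨?_, ?_, ?_, ?_, ?_, h_share, ?_, ?_, hg1, ?_, ?_⟩
  · nlinarith
  · nlinarith
  · nlinarith
  · nlinarith
  · have h : 0 < α * (2 * g - 1 - g * β) := mul_pos (by linarith) (by linarith)
    linear_combination h
  · have h : α * (g * β) < α * (2 * g - 1) := mul_lt_mul_of_pos_left hgβ_lt (by linarith)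
    have h' : α * (3 * g - g ^ 2 - 1) ≤ 3 / 4 * (3 * g - g ^ 2 - 1) :=
      mul_le_mul_of_nonneg_right hα'.le (by nlinarith)
    refine lt_of_mul_lt_mul_left (a := g) ?_ hg0.le
    nlinarith [sq_nonneg (g - 9 / 14)]
  · have : 0 < (1 - g) * β := mul_pos (by linarith) (by linarith)
    nlinarith
  · have h : 0 ≤ (g - α ^ 2) * (α * g ^ 2 + g - 1) := mul_nonneg (by nlinarith) hE
    refine le_of_mul_le_mul_left (a := g) ?_ hg0
    linear_combination h + α * hβg
  · linarith

/-- The balancing inequalities for any `δ ≤ γ̂ = g` above the linear lower bound for `α̂`. -/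
theorem balancing_of_le {α β g δ : ℝ} (hα : 7071 / 10000 < α) (hα' : α < 3 / 4)
    (hβ : 19 / 40 < β) (hβ' : β ≤ α ^ 2) (hgα : g ≤ α)
    (hδ : 7 / 10 * α + 21 / 100 ≤ δ) (hδg : δ ≤ g) :
    α ^ 2 < δ ∧
    (1 - δ) * (α - α * g) < δ * (1 - α) ∧
    (1 - δ) * (1 - g) ≤ δ * g * (1 - α) ∧
    1 - α * g < δ ∧
    (1 - δ) * (α - α * g) < δ * (α * g - α * β) ∧
    (1 - δ) * β < δ * (1 - α) ∧
    α - α * g + α * β < δ ∧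
    (1 - δ) * (α * β) < δ * (1 - α) ∧
    1 ≤ δ * (1 + β) ∧
    1 - δ + (δ + β * δ - 1) * α ≤ δ * (α * g) ∧
    1 + (β - 1) * g < δ := by
  have hβ9 : β < 9 / 16 := by nlinarith
  have hδ7 : 7 / 10 < δ := by linarith
  have hg7 : 7 / 10 < g := by linarith
  have hprod : (1 - δ) * (1 - g) < 9 / 100 := by nlinarith
  have hδα : 498 / 1000 < δ * α := by nlinarith
  have h_share : (1 - δ) * β < δ * (1 - α) := by nlinarith
  refine ⟨?_, ?_, ?_, ?_, ?_, h_share, ?_, ?_, ?_, ?_, ?_⟩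
  · nlinarith
  · nlinarith
  · nlinarith
  · nlinarith
  · have : (1 - δ) * (1 - g) < δ * (g - β) := by nlinarith
    nlinarith
  · nlinarith
  · have : 0 < (1 - δ) * β := mul_pos (by linarith) (by linarith)
    nlinarith
  · nlinarith
  · have hgβ : 7 / 10 * α + 21 / 100 - α ^ 2 ≤ g - β := by linarith
    have h₁ : 498 / 1000 * (g - β) ≤ δ * α * (g - β) :=
      mul_le_mul_of_nonneg_right hδα.le (by linarith)
    have h₂ : (1 - δ) * (1 - α) ≤ (79 / 100 - 7 / 10 * α) * (1 - α) :=
      mul_le_mul_of_nonneg_right (by linarith) (by linarith)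
    nlinarith [mul_pos (sub_pos.2 hα) (sub_pos.2 hα')]
  · nlinarith

theorem gc_balancing_inequalities (α β : ℝ) (h₁ : 1 / Real.sqrt 2 ≤ α) (h₂ : α < 3/4)
    (h₃ : (Real.sqrt (1 + 4 * α) - 1) / 2 ≤ β) (h₄ : β ≤ α^2) :
    let αh : ℝ := (1 - 2 * α + 6 * α^2 - Real.sqrt ((1 - α) * (5 - α))) / (5 * (2 * α - 1))
    let βh : ℝ := α * (1 + α - Real.sqrt ((1 - α)^2 + 4 * α * (α^2 - β)))
      / (2 * (1 - α^2 + β))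
    let γh : ℝ := βh / α
    let δ : ℝ := min αh γh
    α^2 < δ ∧
    (1 - δ) * (α - βh) < δ * (1 - α) ∧
    (1 - δ) * (1 - γh) ≤ δ * γh * (1 - α) ∧
    1 - βh < δ ∧
    (1 - δ) * (α - βh) < δ * (βh - α * β) ∧
    (1 - δ) * β < δ * (1 - α) ∧
    α - βh + α * β < δ ∧
    (1 - δ) * (α * β) < δ * (1 - α) ∧
    1 ≤ δ * (1 + β) ∧
    1 - δ + (δ + β * δ - 1) * α ≤ δ * βh ∧
    1 + (β - 1) * γh < δ := by
  intro αh βh γh δ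
  have hsq := Real.sq_sqrt (show (0 : ℝ) ≤ 2 by norm_num)
  have hα2 : 1 / 2 ≤ α ^ 2 := by
    have h := pow_le_pow_left₀ (by positivity) h₁ 2
    rwa [div_pow, hsq, one_pow] at h
  have hα0 : 0 < α := lt_of_lt_of_le (by positivity) h₁
  have hα : 7071 / 10000 < α := by nlinarith
  have hβ : 19 / 40 < β := by
    have : 39 / 20 < √(1 + 4 * α) := by
      apply Real.lt_sqrt_of_sq_lt; linarith
    linarith
  have hαβ : α ≤ β ^ 2 + β := by
    have h := Real.sq_sqrt (show 0 ≤ 1 + 4 * α by linarith)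
    nlinarith [Real.sqrt_nonneg (1 + 4 * α)]
  have hβh : βh = α * γh := by
    simp only [γh]; field_simp
  have hγ : γh = (1 + α - √((1 - α) ^ 2 + 4 * α * (α ^ 2 - β))) / (2 * (1 - α ^ 2 + β)) := by
    simp only [γh, βh]
    rw [mul_div_assoc, mul_div_cancel_left₀ _ hα0.ne']
  obtain ⟨hq, hg1, hgα⟩ := smaller_root_bounds (by linarith) h₂ (by linarith) h₄ hαβ hγ
  have hℓ : 7 / 10 * α + 21 / 100 ≤ αh := linear_le_alpha_hat (by linarith) h₂
  have hδ : (δ = γh) ∨ (7 / 10 * α + 21 / 100 ≤ δ ∧ δ ≤ γh) := by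
    rcases le_total γh αh with h | h
    · exact Or.inl (min_eq_right h)
    · exact Or.inr ⟨by simpa only [δ, min_eq_left h] using hℓ, min_le_right _ _⟩
  rw [hβh]
  clear_value δ γh βh αh
  clear hβh hγ hℓ hsq h₁ h₃
  generalize γh = g at *
  rcases hδ with rfl | ⟨hδ, hδg⟩
  · exact balancing_of_eq hα h₂ hβ h₄ hq hg1 hgα
  · exact balancing_of_le hα h₂ hβ h₄ hgα hδ hδg
end

section
/- Let α be a real number with 1/√2 ≤ α < 3/4, set α̂ = (1 + α − √((1−α)(5−α)))/(2(2α−1)), α• = 19/24, and R(t) = min{−t, t−1} for real t. Then for all integers k: (i) k < 2α̂k + 2R(α̂) when k ≥ 4; (ii) α²k < α̂k + R(α̂) when k ≥ 5; (iii) (1−α•)·α² < α•·(1−α); (iv) (1−α•)·((1−α̂)k − R(α̂)) < α•(1−α)·(α̂k + R(α̂)) when k ≥ 4; (v) (1−α•)·((1−α̂)k − R(α̂)) < α•(1−α)·((2α̂−1)k + 2R(α̂)) when k ≥ 16; (vi) (1−α)·((1−α̂)k − R(α̂)) + α²k < α̂k + R(α̂) when k ≥ 11; (vii) k + (α²−1)·(α̂k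 + R(α̂)) < α̂k + R(α̂) when k ≥ 31. -/
/-- Strict positivity of an affine function from its value at `m` and its slope. -/
lemma affine_pos_of_le {p q m x : ℝ} (hp : 0 ≤ p) (hm : 0 < p * m + q) (hx : m ≤ x) :
    0 < p * x + q := by
  nlinarith [mul_le_mul_of_nonneg_left hx hp]

/-- An affine lower bound for the root of `(2α - 1)x² - (1 + α)x + 1`, close to its tangent line at `3/4`. -/
lemma affine_le_balancing_root {α : ℝ} (h₁ : 7071/10000 ≤ α) (h₂ : α ≤ 3/4) :
    494/1000 + 3/10 * α ≤
      (1 + α - Real.sqrt ((1 - α) * (5 - α))) / (2 * (2 * α - 1)) := by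
  rw [le_div_iff₀ (by linarith)]
  have hs : Real.sqrt ((1 - α) * (5 - α)) ≤
      1 + α - (494/1000 + 3/10 * α) * (2 * (2 * α - 1)) := by
    rw [Real.sqrt_le_iff]
    constructor
    · nlinarith
    · nlinarith [mul_nonneg (sub_nonneg.2 h₁) (sub_nonneg.2 h₂), sq_nonneg (α - 3/4),
        mul_nonneg (sub_nonneg.2 h₁) (sq_nonneg (α - 3/4)), sq_nonneg (α * (α - 3/4))]
  linarith

theorem robust_c_balancing_inequalities (α : ℝ)
    (h₁ : 1 / Real.sqrt 2 ≤ α) (h₂ : α < 3/4) :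
    let αh : ℝ := (1 + α - Real.sqrt ((1 - α) * (5 - α))) / (2 * (2 * α - 1))
    let αb : ℝ := 19/24
    let R : ℝ → ℝ := fun t => min (-t) (t - 1)
    (∀ k : ℤ, 4 ≤ k → (k : ℝ) < 2 * αh * k + 2 * R αh) ∧
    (∀ k : ℤ, 5 ≤ k → α^2 * k < αh * k + R αh) ∧
    ((1 - αb) * α^2 < αb * (1 - α)) ∧
    (∀ k : ℤ, 4 ≤ k → (1 - αb) * ((1 - αh) * k - R αh) < αb * (1 - α) * (αh * k + R αh)) ∧
    (∀ k : ℤ, 16 ≤ k →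
      (1 - αb) * ((1 - αh) * k - R αh) < αb * (1 - α) * ((2 * αh - 1) * k + 2 * R αh)) ∧
    (∀ k : ℤ, 11 ≤ k → (1 - α) * ((1 - αh) * k - R αh) + α^2 * k < αh * k + R αh) ∧
    (∀ k : ℤ, 31 ≤ k → (k : ℝ) + (α^2 - 1) * (αh * k + R αh) < αh * k + R αh) := by
  intro αh αb R
  have ha : 7071/10000 ≤ α := by
    refine le_trans ?_ h₁
    rw [le_div_iff₀ (by positivity)]
    nlinarith [Real.sq_sqrt (show (0 : ℝ) ≤ 2 by norm_num), Real.sqrt_nonneg 2]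
  have hL : 494/1000 + 3/10 * α ≤ αh := affine_le_balancing_root ha h₂.le
  have hR : R αh = -αh := min_eq_left (by linarith)
  have hb : αb = 19/24 := rfl
  rw [hR, hb]
  clear_value αh αb R
  have hq : 0 ≤ (α - 7071/10000) * (3/4 - α) :=
    mul_nonneg (by linarith) (by linarith)
  have hLα : 0 ≤ (αh - (494/1000 + 3/10 * α)) * (1 - α) :=
    mul_nonneg (by linarith) (by linarith)
  have hLα' : 0 ≤ (αh - (494/1000 + 3/10 * α)) * (2 - α ^ 2) :=
    mul_nonneg (by linarith) (by nlinarith)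
  have cast_le {m k : ℤ} (h : m ≤ k) : (m : ℝ) ≤ k := by exact_mod_cast h
  refine ⟨fun k hk => ?_, fun k hk => ?_, by nlinarith, fun k hk => ?_, fun k hk => ?_,
    fun k hk => ?_, fun k hk => ?_⟩
  · have := affine_pos_of_le (p := 2 * αh - 1)
      (q := -2 * αh) (by nlinarith) (by push_cast; nlinarith) (cast_le hk)
    linarith
  · have := affine_pos_of_le (p := αh - α ^ 2)
      (q := -αh) (by nlinarith) (by push_cast; nlinarith) (cast_le hk)
    linarith
  · have := affine_pos_of_le (p := 19/24 * (1 - α) * αh - 5/24 * (1 - αh))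
      (q := -(19/24 * (1 - α) * αh) - 5/24 * αh) (by nlinarith) (by push_cast; nlinarith) (cast_le hk)
    linarith
  · have := affine_pos_of_le (p := 19/24 * (1 - α) * (2 * αh - 1) - 5/24 * (1 - αh))
      (q := -(19/24 * (1 - α) * (2 * αh)) - 5/24 * αh) (by nlinarith) (by push_cast; nlinarith) (cast_le hk)
    linarith
  · have := affine_pos_of_le (p := αh - (1 - α) * (1 - αh) - α ^ 2)
      (q := -αh - (1 - α) * αh) (by nlinarith) (by push_cast; nlinarith) (cast_le hk)
    linarith
  · have := affine_pos_of_le (p := (2 - α ^ 2) * αh - 1)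
      (q := -((2 - α ^ 2) * αh)) (by nlinarith) (by push_cast; nlinarith) (cast_le hk)
    linarith
end

section
/- Let α and β be real numbers with 1/√2 ≤ α < 3/4 and ℬ(α) ≤ β ≤ α², where ℬ(α) = (√(1+4α) − 1)/2. Set α̂ = (1 − 2α + 6α² − √((1−α)(5−α)))/(5(2α−1)), β̂ = α·(1 + α − √((1−α)² + 4α(α²−β)))/(2(1−α²+β)), and R(t) = min{−t, t−1}. Then for all integers k: (i) αk < 2β̂k + 2R(β̂) when k ≥ 5; (ii) αβk < β̂k + R(β̂) when k ≥ 5; (iii) α²k < α̂k + R(α̂) when k ≥ 5; (iv) αk < (α+1)·(β̂k + R(β̂)) when k ≥ 9; (v) (1−β̂)k − R(β̂) < α̂k + R(α̂) when k ≥ 7; (vi) αk − (1−α)·(β̂k + R(β̂)) < α̂k + R(α̂) when k ≥ 9; (vii) αk − (1−β)·(β̂k + R(β̂)) < α·(α̂k + R(α̂)) when k ≥ 23; (viii) k < uk + v when k ≥ 5, where u = (2−β)·β̂/α and v = (2−β)·R(β̂)/α + 1. -/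
/-- The smaller root of a quadratic with positive leading coefficient dominates every point left of
the vertex at which the quadratic is nonnegative. -/
lemma le_smaller_root {c p d z : ℝ} (hc : 0 < c) (hz : 2 * c * z ≤ p)
    (hq : 0 ≤ c * z ^ 2 - p * z + d) :
    z ≤ (p - √(p ^ 2 - 4 * c * d)) / (2 * c) := by
  rw [le_div_iff₀ (by positivity)]
  have : √(p ^ 2 - 4 * c * d) ≤ p - 2 * c * z :=
    Real.sqrt_le_iff.2 ⟨by linarith, by nlinarith [mul_nonneg hc.le hq]⟩
  linarith

lemma affine_pos {m c k₀ k : ℝ} (hm : 0 ≤ m) (h₀ : 0 < m * k₀ + c) (hk : k₀ ≤ k) :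
    0 < m * k + c := by
  nlinarith [mul_nonneg hm (sub_nonneg.2 hk)]

lemma affine_pos_of_nonpos {m c k₀ k : ℝ} (hk₀ : 0 < k₀) (hc : c ≤ 0) (h₀ : 0 < m * k₀ + c)
    (hk : k₀ ≤ k) : 0 < m * k + c :=
  affine_pos (pos_of_mul_pos_left (by linarith) hk₀.le).le h₀ hk

lemma pos_of_concave_quadratic {p q c s t z : ℝ} (hc : 0 ≤ c) (hs : 0 < p + q * s - c * s ^ 2)
    (ht : 0 < p + q * t - c * t ^ 2) (hsz : s ≤ z) (hzt : z ≤ t) :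
    0 < p + q * z - c * z ^ 2 := by
  have h := mul_nonneg hc (mul_nonneg (sub_nonneg.2 hsz) (sub_nonneg.2 hzt))
  rcases le_total 0 (q - c * (s + t)) with hq | hq
  · nlinarith [mul_nonneg hq (sub_nonneg.2 hsz)]
  · nlinarith [mul_nonneg_of_nonpos_of_nonpos hq (sub_nonpos.2 hzt)]

lemma alphaHat_lower_bound {α : ℝ} (h₁ : 0.7071 ≤ α) (h₂ : α < 3 / 4) :
    0.72 * α + 0.197 ≤
      (1 - 2 * α + 6 * α ^ 2 - √((1 - α) * (5 - α))) / (5 * (2 * α - 1)) := by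
  rw [le_div_iff₀ (by linarith)]
  have : √((1 - α) * (5 - α)) ≤ 2.625 - 2.125 * α :=
    Real.sqrt_le_iff.2 ⟨by linarith, by nlinarith [sq_nonneg (16 * (1 - α) - (5 - α))]⟩
  nlinarith [mul_nonneg (sub_nonneg.2 h₁) (sub_nonneg.2 h₂.le)]

lemma betaHat_lower_bound {α β b : ℝ} (hα : α = b ^ 2 + b) (hb₁ : 0.478 ≤ b) (hb₂ : b < 1 / 2)
    (h₃ : b ≤ β) (h₄ : β ≤ α ^ 2) :
    b + 3 / 5 * (β - b) ≤ α * (1 + α - √((1 - α) ^ 2 + 4 * α * (α ^ 2 - β)))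
      / (2 * (1 - α ^ 2 + β)) := by
  have hα₁ : 0.706 ≤ α := by nlinarith
  have hα₂ : α < 3 / 4 := by nlinarith
  have hc : 0 < 1 - α ^ 2 + β := by nlinarith
  have ht : 0 ≤ β - b := by linarith
  have hvertex : 2 * (1 - α ^ 2 + β) * (b + 3 / 5 * (β - b)) ≤ α * (1 + α) := by
    have h : 2 * (1 - α ^ 2 + β) * (b + 3 / 5 * (β - b)) ≤ 2 * 1 * (b + 3 / 5 * (α ^ 2 - b)) := by
      gcongr
      nlinarith
    nlinarith
  have hq : 0 ≤ (1 - α ^ 2 + β) * (b + 3 / 5 * (β - b)) ^ 2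
      - α * (1 + α) * (b + 3 / 5 * (β - b)) + α ^ 3 := by
    have hslope : 0 ≤ b ^ 2 + 3 / 5 * (2 * b * (1 - α ^ 2 + b) - α * (1 + α)) := by
      have h : 0 ≤ b + 3 / 5 * ((b + 1) * (1 - b - 3 * b ^ 2 - 2 * b ^ 3)) := by
        have : 3 * b ^ 2 + 2 * b ^ 3 ≤ 1 := by nlinarith
        nlinarith
      have := mul_nonneg (show 0 ≤ b by linarith) h
      subst hα
      linarith
    obtain ⟨t, rfl⟩ : ∃ t, β = b + t := ⟨β - b, by ring⟩
    have ht' : 0 ≤ t := by linarith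
    have hpos : 0 ≤ 1 - α ^ 2 + b := by nlinarith
    have key : (1 - α ^ 2 + (b + t)) * (b + 3 / 5 * (b + t - b)) ^ 2
      - α * (1 + α) * (b + 3 / 5 * (b + t - b)) + α ^ 3
      = t * (b ^ 2 + 3 / 5 * (2 * b * (1 - α ^ 2 + b) - α * (1 + α)))
        + t ^ 2 * (6 / 5 * b + 9 / 25 * t + 9 / 25 * (1 - α ^ 2 + b)) := by
      subst hα; ring
    rw [key]
    have : 0 ≤ b := by linarith
    positivity
  convert le_smaller_root hc hvertex hq using 2
  have : (α * (1 + α)) ^ 2 - 4 * (1 - α ^ 2 + β) * α ^ 3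
      = α ^ 2 * ((1 - α) ^ 2 + 4 * α * (α ^ 2 - β)) := by ring
  rw [this, Real.sqrt_mul (sq_nonneg α), Real.sqrt_sq (by linarith)]
  ring

lemma weighted_sum_bounds {α β b : ℝ} (hα : α = b ^ 2 + b) (hα₁ : 0.7071 ≤ α)
    (hα₂ : α < 3 / 4) (hb₁ : 0.478 ≤ b) (hb₂ : b < 1 / 2) (h₃ : b ≤ β) (h₄ : β ≤ α ^ 2) :
    23 * α < 22 * (α * (0.72 * α + 0.197)) + (1 - β) * (22 * (b + 3 / 5 * (β - b))) ∧
    23 * α < 22 * (α * (0.72 * α + 0.197))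
      + (1 - β) * (24 * (b + 3 / 5 * (β - b)) - 1) := by
  have hbα : 0.12 + 0.506 * α ≤ b := by nlinarith
  have hcoef : 0 ≤ (1 - α ^ 2) * (b - (0.12 + 0.506 * α)) :=
    mul_nonneg (by nlinarith) (by linarith)
  have hq : 0 ≤ (α - 0.7071) * (3 / 4 - α) := mul_nonneg (by linarith) (by linarith)
  constructor
  · have := pos_of_concave_quadratic (p := 22 * (α * (0.72 * α + 0.197)) - 23 * α + 44 / 5 * b)
      (q := 66 / 5 - 44 / 5 * b) (c := 66 / 5) (by norm_num) (s := b) (t := α ^ 2) (z := β)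
      (by nlinarith) (by nlinarith) h₃ h₄
    linarith
  · have := pos_of_concave_quadratic (p := 22 * (α * (0.72 * α + 0.197)) - 23 * α + 48 / 5 * b - 1)
      (q := 77 / 5 - 48 / 5 * b) (c := 72 / 5) (by norm_num) (s := b) (t := α ^ 2) (z := β)
      (by nlinarith) (by nlinarith) h₃ h₄
    linarith

lemma balancing_inequalities_of_bounds {α β b x y r : ℝ} (hα : α = b ^ 2 + b) (hα₁ : 0.7071 ≤ α)
    (hb₁ : 0.478 ≤ b) (hb₂ : b < 1 / 2) (h₃ : b ≤ β) (h₄ : β ≤ α ^ 2)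
    (hx : b + 3 / 5 * (β - b) ≤ x) (hy : 0.72 * α + 0.197 ≤ y) (hr : r = -x ∨ r = x - 1)
    (hr₀ : r ≤ 0) (k : ℝ) :
    (5 ≤ k → α * k < 2 * x * k + 2 * r) ∧
    (5 ≤ k → α * β * k < x * k + r) ∧
    (5 ≤ k → α ^ 2 * k < y * k - y) ∧
    (9 ≤ k → α * k < (α + 1) * (x * k + r)) ∧
    (7 ≤ k → (1 - x) * k - r < y * k - y) ∧
    (9 ≤ k → α * k - (1 - α) * (x * k + r) < y * k - y) ∧
    (23 ≤ k → α * k - (1 - β) * (x * k + r) < α * (y * k - y)) ∧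
    (5 ≤ k → α * (k - 1) < (2 - β) * (x * k + r)) := by
  have hα₂ : α < 3 / 4 := by nlinarith
  have hxb : b ≤ x := by linarith
  have hβ : β < 0.5625 := by nlinarith
  have hβr : (1 - β) * r ≤ 0 := mul_nonpos_of_nonneg_of_nonpos (by linarith) hr₀
  have hαr : (1 - α) * r ≤ 0 := mul_nonpos_of_nonneg_of_nonpos (by linarith) hr₀
  have hβx₂ : 0 ≤ (2 - β) * (x - (b + 3 / 5 * (β - b))) := mul_nonneg (by linarith) (by linarith)
  refine ⟨fun hk => ?_, fun hk => ?_, fun hk => ?_, fun hk => ?_, fun hk => ?_, fun hk => ?_,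
    fun hk => ?_, fun hk => ?_⟩
  · have h₀ : 0 < (2 * x - α) * 5 + 2 * r := by
      rcases hr with rfl | rfl <;> nlinarith
    have := affine_pos_of_nonpos (by norm_num) (by linarith) h₀ hk
    linarith
  · have h₀ : 0 < (x - α * β) * 5 + r := by
      rcases hr with rfl | rfl <;> nlinarith
    have := affine_pos_of_nonpos (by norm_num) hr₀ h₀ hk
    linarith
  · have h₀ : 0 < (y - α ^ 2) * 5 + -y := by
      nlinarith
    have := affine_pos_of_nonpos (by norm_num) (by linarith) h₀ hk
    linarith
  · have h₀ : 0 < ((α + 1) * x - α) * 9 + ((α + 1) * r) := by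
      have hαx : 0 ≤ (α + 1) * (x - b) := mul_nonneg (by linarith) (by linarith)
      have h1 : 9 * α < (α + 1) * (8 * b) := by subst hα; nlinarith
      have h2 : 9 * α < (α + 1) * (10 * b - 1) := by subst hα; nlinarith
      rcases hr with rfl | rfl <;> linarith
    have := affine_pos_of_nonpos (by norm_num)
      (mul_nonpos_of_nonneg_of_nonpos (by linarith) hr₀) h₀ hk
    linarith
  · have h₀ : 0 < (x + y - 1) * 7 + (r - y) := by
      rcases hr with rfl | rfl <;> linarith
    have := affine_pos_of_nonpos (by norm_num) (by linarith) h₀ hk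
    linarith
  · have h₀ : 0 < (y - α + (1 - α) * x) * 9 + ((1 - α) * r - y) := by
      have hαx : 0 ≤ (1 - α) * (x - b) := mul_nonneg (by linarith) (by linarith)
      have h1 : 9 * α < 8 * (0.72 * α + 0.197) + (1 - α) * (8 * b) := by subst hα; nlinarith
      have h2 : 9 * α < 8 * (0.72 * α + 0.197) + (1 - α) * (10 * b - 1) := by subst hα; nlinarith
      rcases hr with rfl | rfl <;> linarith
    have := affine_pos_of_nonpos (by norm_num) (by linarith) h₀ hk
    linarith
  · have h₀ : 0 < (α * y - α + (1 - β) * x) * 23 + ((1 - β) * r - α * y) := by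
      have hβx : 0 ≤ (1 - β) * (x - (b + 3 / 5 * (β - b))) := mul_nonneg (by linarith) (by linarith)
      have hαy : 0 ≤ α * (y - (0.72 * α + 0.197)) := mul_nonneg (by linarith) (by linarith)
      obtain ⟨h1, h2⟩ := weighted_sum_bounds hα hα₁ hα₂ hb₁ hb₂ h₃ h₄
      rcases hr with rfl | rfl <;> linarith
    have := affine_pos_of_nonpos (by norm_num) (by nlinarith) h₀ hk
    linarith
  · have hm : 0 ≤ (2 - β) * x - α := by nlinarith
    have h₀ : 0 < ((2 - β) * x - α) * 5 + ((2 - β) * r + α) := by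
      have h1 : α < (2 - β) * (b + 3 / 5 * (β - b)) := by nlinarith
      have h2 : 4 * α < (2 - β) * (6 * (b + 3 / 5 * (β - b)) - 1) := by nlinarith
      rcases hr with rfl | rfl <;> linarith
    have := affine_pos hm h₀ hk
    linarith

theorem robust_gc_balancing_inequalities (α β : ℝ)
    (h₁ : 1 / Real.sqrt 2 ≤ α) (h₂ : α < 3/4)
    (h₃ : (Real.sqrt (1 + 4 * α) - 1) / 2 ≤ β) (h₄ : β ≤ α^2) :
    let αh : ℝ := (1 - 2 * α + 6 * α^2 - Real.sqrt ((1 - α) * (5 - α))) / (5 * (2 * α - 1))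
    let βh : ℝ := α * (1 + α - Real.sqrt ((1 - α)^2 + 4 * α * (α^2 - β)))
      / (2 * (1 - α^2 + β))
    let R : ℝ → ℝ := fun t => min (-t) (t - 1)
    let u : ℝ := (2 - β) * βh / α
    let v : ℝ := (2 - β) * R βh / α + 1
    (∀ k : ℤ, 5 ≤ k → α * k < 2 * βh * k + 2 * R βh) ∧
    (∀ k : ℤ, 5 ≤ k → α * β * k < βh * k + R βh) ∧
    (∀ k : ℤ, 5 ≤ k → α^2 * k < αh * k + R αh) ∧
    (∀ k : ℤ, 9 ≤ k → α * k < (α + 1) * (βh * k + R βh)) ∧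
    (∀ k : ℤ, 7 ≤ k → (1 - βh) * k - R βh < αh * k + R αh) ∧
    (∀ k : ℤ, 9 ≤ k → α * k - (1 - α) * (βh * k + R βh) < αh * k + R αh) ∧
    (∀ k : ℤ, 23 ≤ k → α * k - (1 - β) * (βh * k + R βh) < α * (αh * k + R αh)) ∧
    (∀ k : ℤ, 5 ≤ k → (k : ℝ) < u * k + v) := by
  intro αh βh R u v
  have hα₁ : 0.7071 ≤ α := by
    refine le_trans ?_ h₁
    rw [le_div_iff₀ (by positivity)]
    nlinarith [Real.sq_sqrt (show (0 : ℝ) ≤ 2 by norm_num), Real.sqrt_nonneg 2]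
  obtain ⟨b, hb⟩ : ∃ b, b = (√(1 + 4 * α) - 1) / 2 := ⟨_, rfl⟩
  have hsq : √(1 + 4 * α) ^ 2 = 1 + 4 * α := Real.sq_sqrt (by linarith)
  have hs : √(1 + 4 * α) = 2 * b + 1 := by linarith
  have hb₀ : 0 ≤ 2 * b + 1 := hs ▸ Real.sqrt_nonneg _
  rw [hs] at hsq
  have hα : α = b ^ 2 + b := by linarith
  have hb₁ : 0.478 ≤ b := by nlinarith
  have hb₂ : b < 1 / 2 := by nlinarith
  have h₃' : b ≤ β := hb ▸ h₃
  have hx : b + 3 / 5 * (β - b) ≤ βh := betaHat_lower_bound hα hb₁ hb₂ h₃' h₄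
  have hy : 0.72 * α + 0.197 ≤ αh := alphaHat_lower_bound hα₁ h₂
  have hRy : R αh = -αh := min_eq_left (by linarith)
  have key := balancing_inequalities_of_bounds hα hα₁ hb₁ hb₂ h₃' h₄ hx hy
    (min_choice (-βh) (βh - 1)) (min_le_of_left_le (by linarith))
  rw [hRy]
  refine ⟨fun k hk => (key k).1 (by exact_mod_cast hk),
    fun k hk => (key k).2.1 (by exact_mod_cast hk),
    fun k hk => (key k).2.2.1 (by exact_mod_cast hk),
    fun k hk => (key k).2.2.2.1 (by exact_mod_cast hk),
    fun k hk => (key k).2.2.2.2.1 (by exact_mod_cast hk),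
    fun k hk => (key k).2.2.2.2.2.1 (by exact_mod_cast hk),
    fun k hk => (key k).2.2.2.2.2.2.1 (by exact_mod_cast hk), fun k hk => ?_⟩
  have h_last : α * (k - 1) < (2 - β) * (βh * k + R βh) :=
    (key k).2.2.2.2.2.2.2 (by exact_mod_cast hk)
  have hpos : 0 < α := by linarith
  have huv : u * k + v = (2 - β) * (βh * k + R βh) / α + 1 := by
    simp only [u, v]
    ring
  rw [huv, ← sub_lt_iff_lt_add, lt_div_iff₀ hpos]
  linarith
end

section
/- Let α and β be real numbers with 1/√2 < α < 3/4 and ℬ(α) < β < α², where ℬ(α) = (√(1+4α) − 1)/2. Set α̂ = (1 − 2α + 6α² − √((1−α)(5−α)))/(5(2α−1)) and β̂ = α·(1 + α − √((1−α)² + 4α(α²−β)))/(2(1−α²+β)). Then min{α − α̂, β − β̂, 1/62} ≥ min{α − 1/√2, β − ℬ(α), α² − β}/12. -/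
/-- A lower bound for `α - α̂` in terms of `c = 1 / √2`. -/
lemma sub_alphaHat_ge {a c : ℝ} (hc : 707 / 1000 < c) (hc2 : c ^ 2 = 1 / 2) (hca : c < a)
    (ha : a < 3 / 4) :
    (a - c) / 12 ≤
      a - (1 - 2 * a + 6 * a ^ 2 - Real.sqrt ((1 - a) * (5 - a))) / (5 * (2 * a - 1)) := by
  have hpos : 0 < 5 * (2 * a - 1) := by linarith
  have hcore : 0 ≤ 8 * (1 - a) * (a + c) - 10 / 12 * ((1 - a) * (4 * a + 1))
      - 25 / 144 * ((2 * a - 1) * (a - c)) := by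
    nlinarith [mul_pos (sub_pos.2 hca) (by linarith : 0 < 1 - a),
      mul_pos (sub_pos.2 hca) (by linarith : 0 < 3 / 4 - a)]
  have hmul : 0 ≤ (2 * a - 1) * (a - c) :=
    mul_nonneg (by linarith) (by linarith)
  have hsqrt : (1 - a) * (4 * a + 1) + 5 * (2 * a - 1) * ((a - c) / 12) ≤
      Real.sqrt ((1 - a) * (5 - a)) := by
    apply Real.le_sqrt_of_sq_le
    have hprod := mul_nonneg hmul hcore
    have hid : (1 - a) * (5 - a) -
        ((1 - a) * (4 * a + 1) + 5 * (2 * a - 1) * ((a - c) / 12)) ^ 2 =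
        (2 * a - 1) * (a - c) * (8 * (1 - a) * (a + c) - 10 / 12 * ((1 - a) * (4 * a + 1))
          - 25 / 144 * ((2 * a - 1) * (a - c))) := by
      linear_combination 8 * (1 - a) * (2 * a - 1) * hc2
    linarith
  rw [le_sub_comm, div_le_iff₀ hpos]
  nlinarith

/-- The smaller root of `(1 - a² + b) X² - a (1 + a) X + a³` lies below every point where this
quadratic is nonpositive. -/
lemma betaHat_le_of_quadratic_nonpos {a b x : ℝ} (ha : 0 < a) (hab : 0 < 1 - a ^ 2 + b)
    (hx : (1 - a ^ 2 + b) * x ^ 2 - a * (1 + a) * x + a ^ 3 ≤ 0) :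
    a * (1 + a - Real.sqrt ((1 - a) ^ 2 + 4 * a * (a ^ 2 - b))) / (2 * (1 - a ^ 2 + b)) ≤ x := by
  have hsqrt : (a * (1 + a) - 2 * (1 - a ^ 2 + b) * x) / a ≤
      Real.sqrt ((1 - a) ^ 2 + 4 * a * (a ^ 2 - b)) := by
    apply Real.le_sqrt_of_sq_le
    rw [div_pow, div_le_iff₀ (by positivity)]
    nlinarith [mul_nonneg hab.le (neg_nonneg.2 hx)]
  rw [div_le_iff₀ ha] at hsqrt
  rw [div_le_iff₀ (by linarith)]
  linarith

/-- A lower bound for `β - β̂`, where `B` is the positive root of `X² + X = a`. -/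
lemma sub_betaHat_ge {a b B e : ℝ} (ha₁ : 707 / 1000 < a) (ha₁' : 1 / 2 < a ^ 2)
    (ha₂ : a < 3 / 4) (hB : 0 < B) (hBa : B ^ 2 + B = a) (hb₂ : b < a ^ 2)
    (he : 0 < e) (he₁ : e ≤ (b - B) / 12) (he₂ : e ≤ (a ^ 2 - b) / 12) :
    e ≤ b - a * (1 + a - Real.sqrt ((1 - a) ^ 2 + 4 * a * (a ^ 2 - b))) /
      (2 * (1 - a ^ 2 + b)) := by
  have hBlow : 475 / 1000 < B := by nlinarith
  have hBup : B ≤ (a + 228484 / 1000000) / (1956 / 1000) := by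
    rw [le_div_iff₀ (by norm_num)]
    nlinarith [sq_nonneg (B - 478 / 1000)]
  have hw : a - a ^ 2 ≤ 10 * (a ^ 2 - B) := by
    nlinarith
  have ha2 : a ^ 2 < 9 / 16 := by nlinarith
  have hP : (1 - a ^ 2 + b) * (b - e) ^ 2 - a * (1 + a) * (b - e) + a ^ 3 =
      -((a ^ 2 - b) * (b - B) * (b + B + 1))
        + e * (a - a ^ 2 + 2 * (a ^ 2 - b) * (1 + b) + e * (1 - (a ^ 2 - b))) := by
    subst hBa; ring
  -- the larger of the two gaps, `M`, controls the linear coefficient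
  have hkey : ∀ m M : ℝ, 12 * e ≤ m → m ≤ M → a ^ 2 - B ≤ 2 * M → a ^ 2 - b ≤ M →
      e * (a - a ^ 2 + 2 * (a ^ 2 - b) * (1 + b) + e * (1 - (a ^ 2 - b))) ≤
        m * M * (b + B + 1) := by
    intro m M hm hmM hM ht
    have hlin : a - a ^ 2 + 2 * (a ^ 2 - b) * (1 + b) + e * (1 - (a ^ 2 - b)) ≤
        12 * M * (b + B + 1) := by
      have h1 : 2 * (a ^ 2 - b) * (1 + b) ≤ (a ^ 2 - b) * (25 / 8) := by nlinarith
      have h2 : e * (1 - (a ^ 2 - b)) ≤ e := by nlinarith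
      have h3 : M * (195 / 100) ≤ M * (b + B + 1) :=
        mul_le_mul_of_nonneg_left (by linarith) (by linarith)
      linarith
    have hR : 0 ≤ M * (b + B + 1) := mul_nonneg (by linarith) (by linarith)
    calc _ ≤ e * (12 * M * (b + B + 1)) := mul_le_mul_of_nonneg_left hlin he.le
      _ = 12 * e * (M * (b + B + 1)) := by ring
      _ ≤ m * (M * (b + B + 1)) := mul_le_mul_of_nonneg_right hm hR
      _ = _ := by ring
  rw [le_sub_comm]
  apply betaHat_le_of_quadratic_nonpos (by linarith) (by nlinarith)
  rw [hP]
  rcases le_total (a ^ 2 - b) (b - B) with h | h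
  · have := hkey (a ^ 2 - b) (b - B) (by linarith) h (by linarith) h
    linarith
  · have := hkey (b - B) (a ^ 2 - b) (by linarith) h (by linarith) le_rfl
    linarith


theorem delta_lower_bound (α β : ℝ)
    (h₁ : 1 / Real.sqrt 2 < α) (h₂ : α < 3/4)
    (h₃ : (Real.sqrt (1 + 4 * α) - 1) / 2 < β) (h₄ : β < α^2) :
    let αh : ℝ := (1 - 2 * α + 6 * α^2 - Real.sqrt ((1 - α) * (5 - α))) / (5 * (2 * α - 1))
    let βh : ℝ := α * (1 + α - Real.sqrt ((1 - α)^2 + 4 * α * (α^2 - β)))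
      / (2 * (1 - α^2 + β))
    min (α - 1 / Real.sqrt 2) (min (β - (Real.sqrt (1 + 4 * α) - 1) / 2) (α^2 - β)) / 12 ≤
      min (α - αh) (min (β - βh) (1/62)) := by

  intro αh βh
  have hc2 : (1 / Real.sqrt 2) ^ 2 = 1 / 2 := by
    rw [div_pow, Real.sq_sqrt (by norm_num)]; norm_num
  have hcpos : 0 < 1 / Real.sqrt 2 := by positivity
  have hs : Real.sqrt (1 + 4 * α) ^ 2 = 1 + 4 * α := Real.sq_sqrt (by linarith)
  have hs1 : 1 < Real.sqrt (1 + 4 * α) := Real.lt_sqrt_of_sq_lt (by linarith)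
  set c := 1 / Real.sqrt 2
  set B := (Real.sqrt (1 + 4 * α) - 1) / 2 with hBdef
  have hc : 707 / 1000 < c := by nlinarith
  have hBa : B ^ 2 + B = α := by rw [hBdef]; linear_combination hs / 4
  set m := min (α - c) (min (β - B) (α ^ 2 - β))
  have hm : 0 < m := lt_min (by linarith) (lt_min (by linarith) (by linarith))
  have hm₁ : m ≤ α - c := min_le_left _ _
  have hm₂ : m ≤ β - B := (min_le_right _ _).trans (min_le_left _ _)
  have hm₃ : m ≤ α ^ 2 - β := (min_le_right _ _).trans (min_le_right _ _)
  refine le_min ?_ (le_min ?_ ?_)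
  · have := sub_alphaHat_ge hc hc2 h₁ h₂
    exact le_trans (by linarith) this
  · exact sub_betaHat_ge (by linarith) (by nlinarith) h₂ (by linarith) hBa h₄ (by linarith)
      (by linarith) (by linarith)
  · linarith
end
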